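/- arXiv:2210.04694 — 3 statements merged into one kernel-verified Lean document; each statement's English description precedes it below -/
import Mathlib

section
/- Let W be a d-dimensional Brownian sheet on [0,1]^2 and let b : [0,1]^2 × ℝ^d → ℝ be Borel measurable with |b(s,t,x)| ≤ 1 everywhere. Then there exist a set Ω₂ ⊂ Ω with ℙ(Ω₂) = 1 and a positive random variable C₂ such that for all ω ∈ Ω₂, all dyadic points x ∈ [−1,1]^d, and all integers n ≥ 1, 0 ≤ k, k' ≤ 2^n − 1, one has |ϱ_{nkk'}(0,x)(ω)| ≤ C₂(ω) √n 2^{−n} ( |x| + 2^{−4^n} ). -/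
open MeasureTheory ProbabilityTheory Set Filter

noncomputable section

/-- A `d`-dimensional Brownian sheet on `[0,1]²`. -/
def IsBrownianSheet {Ω : Type*} [MeasurableSpace Ω] (P : Measure Ω) (d : ℕ)
    (W : ℝ × ℝ → Ω → EuclideanSpace ℝ (Fin d)) : Prop :=
  (∀ p, Measurable (W p)) ∧
  (∀ ω, ContinuousOn (fun p => W p ω) (Set.Icc (0 : ℝ × ℝ) 1)) ∧
  (∀ ω, ∀ p ∈ Set.Icc (0 : ℝ × ℝ) 1, p.1 = 0 ∨ p.2 = 0 → W p ω = 0) ∧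
  (∀ (n : ℕ) (p : Fin n → ℝ × ℝ) (idx : Fin n → Fin d) (c : Fin n → ℝ),
    (∀ j, p j ∈ Set.Icc (0 : ℝ × ℝ) 1) →
    P.map (fun ω => ∑ j, c j * W (p j) ω (idx j)) =
      gaussianReal 0 (∑ j, ∑ k, c j * c k *
        (if idx j = idx k then min (p j).1 (p k).1 * min (p j).2 (p k).2 else 0)).toNNReal)

/-- The σ-algebra generated by the sheet up to `p`. -/
def sheetSigma {Ω : Type*} [MeasurableSpace Ω] {d : ℕ}
    (W : ℝ × ℝ → Ω → EuclideanSpace ℝ (Fin d)) (p : ℝ × ℝ) : MeasurableSpace Ω :=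
  ⨆ q ∈ Set.Icc (0 : ℝ × ℝ) p, MeasurableSpace.comap (W q) inferInstance

/-- A strong solution of the sheet SDE. -/
def IsStrongSolution {Ω : Type*} [MeasurableSpace Ω] (P : Measure Ω) {d : ℕ}
    (W : ℝ × ℝ → Ω → EuclideanSpace ℝ (Fin d))
    (b : ℝ × ℝ → EuclideanSpace ℝ (Fin d) → EuclideanSpace ℝ (Fin d))
    (ξ : EuclideanSpace ℝ (Fin d))
    (X : ℝ × ℝ → Ω → EuclideanSpace ℝ (Fin d)) : Prop :=
  (∀ ω, ContinuousOn (fun p => X p ω) (Set.Icc (0 : ℝ × ℝ) 1)) ∧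
  (∀ p ∈ Set.Icc (0 : ℝ × ℝ) 1, ∃ Y : Ω → EuclideanSpace ℝ (Fin d),
      Measurable[sheetSigma W p] Y ∧ ∀ᵐ ω ∂P, X p ω = Y ω) ∧
  (∀ᵐ ω ∂P, ∀ p ∈ Set.Icc (0 : ℝ × ℝ) 1,
      X p ω = ξ + (∫ t₁ in (0:ℝ)..p.2, ∫ s₁ in (0:ℝ)..p.1, b (s₁, t₁) (X (s₁, t₁) ω)) + W p ω)

/-- A point of `ℝ^d` is dyadic if all its coordinates are dyadic rationals. -/
def IsDyadicPoint {d : ℕ} (x : EuclideanSpace ℝ (Fin d)) : Prop :=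
  ∀ i, ∃ (m : ℤ) (l : ℕ), x i = (m : ℝ) / 2 ^ l

open scoped RealInnerProductSpace

lemma abs_integral_le_of_abs_le {α : Type*} [MeasurableSpace α] {μ : Measure α}
    [IsProbabilityMeasure μ] {f : α → ℝ} {M : ℝ} (h : ∀ z, |f z| ≤ M) : |∫ z, f z ∂μ| ≤ M := by
  have := norm_integral_le_of_norm_le_const (μ := μ) (f := f) (C := M) (ae_of_all _ h)
  simpa using this

/-- Shifting a standard real Gaussian by `a` changes expectations of bounded functions by `O(|a|)`. -/
lemma abs_integral_gaussianReal_shift_le {f : ℝ → ℝ} (hf : Measurable f) {M : ℝ}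
    (hM : ∀ z, |f z| ≤ M) (a : ℝ) :
    |∫ z, f (z + a) ∂gaussianReal 0 1 - ∫ z, f z ∂gaussianReal 0 1| ≤ 2 * M * |a| := by
  have hM0 : 0 ≤ M := (abs_nonneg _).trans (hM 0)
  have hbd : ∀ (μ : Measure ℝ) [IsProbabilityMeasure μ] (g : ℝ → ℝ), Measurable g →
      (∀ z, |g z| ≤ M) → Integrable g μ := fun μ _ g hg h =>
    Integrable.of_bound hg.aestronglyMeasurable M (ae_of_all _ (by simpa using h))
  rcases lt_or_ge 1 |a| with ha | ha
  · have h1 : |∫ z, f (z + a) ∂gaussianReal 0 1| ≤ M :=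
      abs_integral_le_of_abs_le fun z => hM _
    have h2 : |∫ z, f z ∂gaussianReal 0 1| ≤ M :=
      abs_integral_le_of_abs_le fun z => hM _
    calc _ ≤ |∫ z, f (z + a) ∂gaussianReal 0 1| + |∫ z, f z ∂gaussianReal 0 1| := abs_sub _ _
      _ ≤ 2 * M * 1 := by linarith
      _ ≤ _ := by gcongr
  rcases eq_or_ne a 0 with rfl | ha0
  · simp
  have e1 : ∫ z, f (z + a) ∂gaussianReal 0 1
      = ∫ z, Real.exp (a * z - a ^ 2 / 2) * f z ∂gaussianReal 0 1 := by
    have : ∫ z, f (z + a) ∂gaussianReal 0 1 = ∫ z, f z ∂gaussianReal a 1 := by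
      rw [← zero_add a, ← gaussianReal_map_add_const a, integral_map (by fun_prop)
        hf.aestronglyMeasurable]
      simp
    rw [this, integral_gaussianReal_eq_integral_smul one_ne_zero,
      integral_gaussianReal_eq_integral_smul one_ne_zero]
    congr 1
    ext z
    simp only [gaussianPDFReal, smul_eq_mul, NNReal.coe_one, sub_zero]
    rw [mul_assoc _ (Real.exp _) (_ * _), ← mul_assoc (Real.exp _) (Real.exp _), ← Real.exp_add,
      mul_assoc]
    congr 3
    ring
  set X : ℝ → ℝ := fun z => Real.exp (a * z - a ^ 2 / 2) - 1 with hX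
  have hexp : ∀ t : ℝ, Integrable (fun z => Real.exp (t * z)) (gaussianReal 0 1) :=
    fun t => integrable_exp_mul_gaussianReal t
  have hexpv : ∀ t : ℝ, ∫ z, Real.exp (t * z) ∂gaussianReal 0 1 = Real.exp (t ^ 2 / 2) := by
    intro t
    have := congrFun (mgf_fun_id_gaussianReal (μ := 0) (v := 1)) t
    simpa [mgf] using this
  have hi1 : Integrable (fun z => Real.exp (a * z - a ^ 2 / 2)) (gaussianReal 0 1) := by
    simp_rw [Real.exp_sub, div_eq_mul_inv]
    exact (hexp a).mul_const _
  have hX2e : ∀ z, X z ^ 2 = Real.exp (-a ^ 2) * Real.exp (2 * a * z)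
      - 2 * Real.exp (-(a ^ 2 / 2)) * Real.exp (a * z) + 1 := by
    intro z
    have h1 : Real.exp (a * z - a ^ 2 / 2) = Real.exp (-(a ^ 2 / 2)) * Real.exp (a * z) := by
      rw [← Real.exp_add]; ring_nf
    have h2 : Real.exp (-a ^ 2) * Real.exp (2 * a * z)
        = (Real.exp (-(a ^ 2 / 2)) * Real.exp (a * z)) ^ 2 := by
      rw [← Real.exp_add, ← Real.exp_add, ← Real.exp_nat_mul]; push_cast; ring_nf
    rw [h2, hX]; simp only [h1]; ring
  have hiA : Integrable (fun z => Real.exp (-a ^ 2) * Real.exp (2 * a * z)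
      - 2 * Real.exp (-(a ^ 2 / 2)) * Real.exp (a * z)) (gaussianReal 0 1) :=
    ((hexp (2 * a)).const_mul _).sub ((hexp a).const_mul _)
  have hiX2 : Integrable (fun z => X z ^ 2) (gaussianReal 0 1) := by
    simp_rw [hX2e]
    exact hiA.add (integrable_const _)
  have hX2 : ∫ z, X z ^ 2 ∂gaussianReal 0 1 ≤ 2 * a ^ 2 := by
    simp_rw [hX2e]
    rw [integral_add hiA (integrable_const _), integral_sub ((hexp (2 * a)).const_mul _)
      ((hexp a).const_mul _), integral_const_mul, integral_const_mul, hexpv, hexpv]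
    have e1 : Real.exp (-a ^ 2) * Real.exp ((2 * a) ^ 2 / 2) = Real.exp (a ^ 2) := by
      rw [← Real.exp_add]; ring_nf
    have e2 : 2 * Real.exp (-(a ^ 2 / 2)) * Real.exp (a ^ 2 / 2) = 2 := by
      rw [mul_assoc, ← Real.exp_add]; simp
    rw [e1, e2]
    have ha2 : a ^ 2 ≤ 1 := by
      rw [← sq_abs]; exact pow_le_one₀ (abs_nonneg _) ha
    have := (abs_le.1 (Real.abs_exp_sub_one_sub_id_le (x := a ^ 2)
      (by rwa [abs_of_nonneg (sq_nonneg a)]))).2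
    simp
    nlinarith [sq_nonneg a]
  have hiX : Integrable X (gaussianReal 0 1) := hi1.sub (integrable_const _)
  have hapos : 0 < |a| := abs_pos.2 ha0
  have hXabs : ∫ z, |X z| ∂gaussianReal 0 1 ≤ 2 * |a| := by
    calc ∫ z, |X z| ∂gaussianReal 0 1
        ≤ ∫ z, (X z ^ 2 * (1 / (2 * |a|)) + |a| / 2) ∂gaussianReal 0 1 := by
          refine integral_mono hiX.abs ((hiX2.mul_const _).add (integrable_const _)) fun z => ?_
          simp only
          rw [← sub_nonneg]
          have : X z ^ 2 * (1 / (2 * |a|)) + |a| / 2 - |X z|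
              = (|X z| - |a|) ^ 2 / (2 * |a|) := by
            rw [← sq_abs (X z)]; field_simp; ring
          rw [this]; positivity
      _ = (∫ z, X z ^ 2 ∂gaussianReal 0 1) * (1 / (2 * |a|)) + |a| / 2 := by
          rw [integral_add (hiX2.mul_const _) (integrable_const _), integral_mul_const]
          simp
      _ ≤ (2 * a ^ 2) * (1 / (2 * |a|)) + |a| / 2 := by gcongr
      _ = |a| + |a| / 2 := by rw [← sq_abs a]; field_simp
      _ ≤ _ := by linarith
  have hif : Integrable f (gaussianReal 0 1) := hbd _ f hf hM
  have hi1f : Integrable (fun z => Real.exp (a * z - a ^ 2 / 2) * f z) (gaussianReal 0 1) :=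
    hi1.mul_bdd (c := M) hf.aestronglyMeasurable (ae_of_all _ (by simpa using hM))
  rw [e1, ← integral_sub hi1f hif]
  rw [← Real.norm_eq_abs]
  calc ‖∫ z, (Real.exp (a * z - a ^ 2 / 2) * f z - f z) ∂gaussianReal 0 1‖
      ≤ ∫ z, |X z| * M ∂gaussianReal 0 1 := by
        refine norm_integral_le_of_norm_le (hiX.abs.mul_const _) (ae_of_all _ fun z => ?_)
        rw [show Real.exp (a * z - a ^ 2 / 2) * f z - f z = X z * f z by simp [hX]; ring,
          norm_mul, Real.norm_eq_abs, Real.norm_eq_abs]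
        gcongr
        exact hM z
    _ = (∫ z, |X z| ∂gaussianReal 0 1) * M := integral_mul_const _ _
    _ ≤ (2 * |a|) * M := by gcongr
    _ = _ := by ring

section Gaussian

variable {E : Type*} [NormedAddCommGroup E] [InnerProductSpace ℝ E] [FiniteDimensional ℝ E]
  [MeasurableSpace E] [BorelSpace E]

lemma map_prod_gaussianReal_stdGaussian {e : E} (he : ‖e‖ = 1) :
    ((gaussianReal 0 1).prod (stdGaussian E)).map (fun p => p.1 • e + (p.2 - ⟪e, p.2⟫ • e))
      = stdGaussian E := by
  apply Measure.ext_of_charFun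
  ext t
  have hm : Measurable (fun p : ℝ × E => p.1 • e + (p.2 - ⟪e, p.2⟫ • e)) := by fun_prop
  rw [charFun_apply, integral_map hm.aemeasurable
    (Measurable.aestronglyMeasurable (by fun_prop)), charFun_stdGaussian]
  have h1 : ∀ p : ℝ × E, Complex.exp (⟪p.1 • e + (p.2 - ⟪e, p.2⟫ • e), t⟫ * Complex.I)
      = Complex.exp ((⟪e, t⟫ : ℝ) * p.1 * Complex.I)
        * Complex.exp (⟪p.2, t - ⟪e, t⟫ • e⟫ * Complex.I) := by
    intro p
    rw [← Complex.exp_add, ← add_mul]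
    congr 2
    rw [inner_add_left, inner_sub_left, inner_smul_left, inner_smul_left, inner_sub_right,
      inner_smul_right, real_inner_comm p.2 e]
    push_cast
    simp
    ring
  simp_rw [h1]
  rw [integral_prod_mul (μ := gaussianReal 0 1) (ν := stdGaussian E)
    (fun z : ℝ => Complex.exp ((⟪e, t⟫ : ℝ) * z * Complex.I))
    (fun z : E => Complex.exp (⟪z, t - ⟪e, t⟫ • e⟫ * Complex.I)),
    ← charFun_apply_real, ← charFun_apply, charFun_gaussianReal, charFun_stdGaussian,
    ← Complex.exp_add]
  congr 1
  have h2 : ‖t - ⟪e, t⟫ • e‖ ^ 2 = ‖t‖ ^ 2 - ⟪e, t⟫ ^ 2 := by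
    rw [norm_sub_sq_real, inner_smul_right, norm_smul, he, real_inner_comm]
    simp
    ring
  have h3 : ((‖t - ⟪e, t⟫ • e‖ : ℝ) : ℂ) ^ 2 = ((‖t‖ ^ 2 - ⟪e, t⟫ ^ 2 : ℝ) : ℂ) := by
    exact_mod_cast congrArg ((↑) : ℝ → ℂ) h2
  rw [h3]
  push_cast
  simp
  ring

lemma abs_integral_stdGaussian_shift_le {f : E → ℝ} (hf : Measurable f) {M : ℝ}
    (hM : ∀ z, |f z| ≤ M) (x : E) :
    |∫ z, f (z + x) ∂stdGaussian E - ∫ z, f z ∂stdGaussian E| ≤ 2 * M * ‖x‖ := by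
  rcases eq_or_ne x 0 with rfl | hx
  · simp
  have hx0 : ‖x‖ ≠ 0 := norm_ne_zero_iff.2 hx
  set e : E := ‖x‖⁻¹ • x with he_def
  have he : ‖e‖ = 1 := by rw [he_def, norm_smul, norm_inv, norm_norm, inv_mul_cancel₀ hx0]
  have hxe : x = ‖x‖ • e := by rw [he_def, smul_smul, mul_inv_cancel₀ hx0, one_smul]
  have key : ∀ g : E → ℝ, Measurable g → (∀ z, |g z| ≤ M) → ∫ z, g z ∂stdGaussian E
      = ∫ w, ∫ r, g (r • e + (w - ⟪e, w⟫ • e)) ∂gaussianReal 0 1 ∂stdGaussian E := by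
    intro g hg hgM
    conv_lhs => rw [← map_prod_gaussianReal_stdGaussian he]
    rw [integral_map (Measurable.aemeasurable (by fun_prop)) hg.aestronglyMeasurable,
      integral_prod_symm]
    refine Integrable.of_bound (Measurable.aestronglyMeasurable (by fun_prop)) M
      (ae_of_all _ fun z => by simpa using hgM _)
  have hsub : ∀ (r : ℝ) (w : E), r • e + (w - ⟪e, w⟫ • e) + x
      = (r + ‖x‖) • e + (w - ⟪e, w⟫ • e) := by
    intro r w; nth_rewrite 1 [hxe]; rw [add_smul]; abel
  have hint : ∀ c : ℝ, Integrable (fun w => ∫ r, f ((r + c) • e + (w - ⟪e, w⟫ • e))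
      ∂gaussianReal 0 1) (stdGaussian E) := by
    intro c
    refine Integrable.of_bound (C := M) ?_ (ae_of_all _ fun w => ?_)
    · refine StronglyMeasurable.aestronglyMeasurable ?_
      exact StronglyMeasurable.integral_prod_right (ν := gaussianReal 0 1)
        (f := fun w r => f ((r + c) • e + (w - ⟪e, w⟫ • e)))
        (Measurable.stronglyMeasurable (by fun_prop))
    · exact abs_integral_le_of_abs_le fun z => hM _
  rw [key (fun z => f (z + x)) (by fun_prop) (fun z => hM _), key f hf hM]
  simp_rw [hsub]
  have h0 := hint 0
  simp only [add_zero] at h0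
  rw [← integral_sub (hint _) h0]
  refine abs_integral_le_of_abs_le fun w => ?_
  have := abs_integral_gaussianReal_shift_le (f := fun r => f (r • e + (w - ⟪e, w⟫ • e)))
    (by fun_prop) (fun z => hM _) ‖x‖
  simpa using this

/-- The centered Gaussian law with covariance `v` times the identity. -/
def isoGaussian (E : Type*) [NormedAddCommGroup E] [InnerProductSpace ℝ E]
    [FiniteDimensional ℝ E] [MeasurableSpace E] (v : ℝ) : Measure E :=
  (stdGaussian E).map (fun z => √v • z)

instance (v : ℝ) : IsProbabilityMeasure (isoGaussian E v) :=
  Measure.isProbabilityMeasure_map (Measurable.aemeasurable (by fun_prop))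

lemma charFun_isoGaussian {v : ℝ} (hv : 0 ≤ v) (t : E) :
    charFun (isoGaussian E v) t = Complex.exp (-(v * ‖t‖ ^ 2 : ℝ) / 2) := by
  rw [isoGaussian, charFun_map_smul, charFun_stdGaussian, norm_smul]
  congr 2
  rw [← Complex.ofReal_pow, mul_pow, Real.norm_eq_abs, sq_abs, Real.sq_sqrt hv]

lemma abs_integral_isoGaussian_shift_le {f : E → ℝ} (hf : Measurable f) {M : ℝ}
    (hM : ∀ z, |f z| ≤ M) {v : ℝ} (hv : 0 < v) (x : E) :
    |∫ z, f (z + x) ∂isoGaussian E v - ∫ z, f z ∂isoGaussian E v| ≤ 2 * M * ‖x‖ * (√v)⁻¹ := by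
  have hs : √v ≠ 0 := (Real.sqrt_pos.2 hv).ne'
  have hm : Measurable (fun z : E => √v • z) := by fun_prop
  rw [isoGaussian, integral_map hm.aemeasurable (Measurable.aestronglyMeasurable (by fun_prop)),
    integral_map hm.aemeasurable hf.aestronglyMeasurable]
  have := abs_integral_stdGaussian_shift_le (f := fun z => f (√v • z)) (by fun_prop)
    (fun z => hM _) ((√v)⁻¹ • x)
  simp only [smul_add, smul_smul, mul_inv_cancel₀ hs, one_smul, norm_smul] at this
  refine this.trans_eq ?_
  rw [norm_inv, Real.norm_of_nonneg (Real.sqrt_nonneg v)]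
  ring

end Gaussian

namespace IsBrownianSheet

variable {Ω : Type*} [MeasurableSpace Ω] {P : Measure Ω} [IsProbabilityMeasure P] {d : ℕ}
  {W : ℝ × ℝ → Ω → EuclideanSpace ℝ (Fin d)}

omit [IsProbabilityMeasure P] in
lemma map_sum (hW : IsBrownianSheet P d W) {ι : Type*} [Fintype ι] (p : ι → ℝ × ℝ)
    (idx : ι → Fin d) (c : ι → ℝ) (hp : ∀ j, p j ∈ Set.Icc (0 : ℝ × ℝ) 1) :
    P.map (fun ω => ∑ j, c j * W (p j) ω (idx j)) =
      gaussianReal 0 (∑ j, ∑ k, c j * c k *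
        (if idx j = idx k then min (p j).1 (p k).1 * min (p j).2 (p k).2 else 0)).toNNReal := by
  let e := (Fintype.equivFin ι).symm
  have h := hW.2.2.2 _ (p ∘ e) (idx ∘ e) (c ∘ e) (fun j => hp _)
  simp only [Function.comp_apply] at h
  convert h using 3
  · exact (e.sum_comp fun j => c j * W (p j) _ (idx j)).symm
  · rw [← e.sum_comp]
    exact Finset.sum_congr rfl fun j _ => (e.sum_comp _).symm

omit [IsProbabilityMeasure P] in
lemma measurable_coord (hW : IsBrownianSheet P d W) (p : ℝ × ℝ) (i : Fin d) :
    Measurable fun ω => W p ω i :=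
  (EuclideanSpace.proj (𝕜 := ℝ) i).continuous.measurable.comp (hW.1 p)

omit [IsProbabilityMeasure P] in
lemma isGaussianProcess (hW : IsBrownianSheet P d W) :
    IsGaussianProcess
      (fun (a : Set.Icc (0 : ℝ × ℝ) 1 × Fin d) ω => W a.1 ω a.2) P where
  hasGaussianLaw I := by
    constructor
    refine isGaussian_of_map_eq_gaussianReal fun L => ⟨0, (∑ j : I, ∑ k : I,
        L (Pi.single j 1) * L (Pi.single k 1) *
        (if j.1.2 = k.1.2 then min j.1.1.1.1 k.1.1.1.1 * min j.1.1.1.2 k.1.1.1.2 else 0)).toNNReal,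
        ?_⟩
    rw [← hW.map_sum (fun j : I => (j.1.1 : ℝ × ℝ)) (fun j => j.1.2)
        (fun j => L (Pi.single j 1)) (fun j => j.1.1.2), Measure.map_map L.measurable]
    · congr 1
      ext ω
      simp only [Function.comp_apply]
      conv_lhs => rw [← Finset.univ_sum_single
        (I.restrict fun a : Set.Icc (0 : ℝ × ℝ) 1 × Fin d => W a.1 ω a.2)]
      rw [_root_.map_sum]
      refine Finset.sum_congr rfl fun j _ => ?_
      have : (Pi.single j (I.restrict (fun a : Set.Icc (0 : ℝ × ℝ) 1 × Fin d => W a.1 ω a.2) j) :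
          I → ℝ) = (W j.1.1 ω j.1.2) • Pi.single j 1 := by
        rw [← Pi.single_smul]; simp
      rw [this, map_smul, smul_eq_mul, mul_comm]
    · exact measurable_pi_lambda _ fun j => hW.measurable_coord _ _

omit [IsProbabilityMeasure P] in
lemma memLp_two (hW : IsBrownianSheet P d W) {p : ℝ × ℝ} (hp : p ∈ Set.Icc (0 : ℝ × ℝ) 1)
    (i : Fin d) : MemLp (fun ω => W p ω i) 2 P :=
  (hW.isGaussianProcess.hasGaussianLaw_eval (⟨p, hp⟩, i)).memLp_two

lemma covariance_eq (hW : IsBrownianSheet P d W) {p q : ℝ × ℝ}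
    (hp : p ∈ Set.Icc (0 : ℝ × ℝ) 1) (hq : q ∈ Set.Icc (0 : ℝ × ℝ) 1) (i j : Fin d) :
    cov[fun ω => W p ω i, fun ω => W q ω j; P] =
      if i = j then min p.1 q.1 * min p.2 q.2 else 0 := by
  have hvar : ∀ c : Fin 2 → ℝ, (∀ k, 0 ≤ c k) →
      Var[fun ω => ∑ k, c k * W (![p, q] k) ω (![i, j] k); P] =
      c 0 * c 0 * (p.1 * p.2) + 2 * (c 0 * c 1 *
        (if i = j then min p.1 q.1 * min p.2 q.2 else 0)) + c 1 * c 1 * (q.1 * q.2) := by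
    intro c hc
    have hpq : ∀ k, ![p, q] k ∈ Set.Icc (0 : ℝ × ℝ) 1 :=
      Fin.forall_fin_two.2 ⟨hp, hq⟩
    have hm : AEMeasurable (fun ω => ∑ k, c k * W (![p, q] k) ω (![i, j] k)) P :=
      (Finset.measurable_fun_sum _ fun k _ => 
        (hW.measurable_coord (![p, q] k) (![i, j] k)).const_mul (c k)).aemeasurable
    have h := hW.map_sum ![p, q] ![i, j] c hpq
    rw [← variance_id_map hm, h, variance_id_gaussianReal, Real.coe_toNNReal]
    · simp only [Fin.sum_univ_two, Matrix.cons_val_zero, Matrix.cons_val_one, if_true, min_self,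
        min_comm q.1, min_comm q.2, eq_comm (a := j)]
      by_cases hij : i = j <;> simp only [hij, if_true, if_false] <;> ring
    · refine Finset.sum_nonneg fun a _ => Finset.sum_nonneg fun b _ =>
        mul_nonneg (mul_nonneg (hc _) (hc _)) ?_
      split_ifs
      · exact mul_nonneg (le_min (hpq a).1.1 (hpq b).1.1) (le_min (hpq a).1.2 (hpq b).1.2)
      · exact le_rfl
  have h1 := hvar ![1, 1] (Fin.forall_fin_two.2 (by simp))
  have h2 := hvar ![1, 0] (Fin.forall_fin_two.2 (by simp))
  have h3 := hvar ![0, 1] (Fin.forall_fin_two.2 (by simp))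
  simp only [Fin.sum_univ_two, Matrix.cons_val_zero, Matrix.cons_val_one, one_mul, zero_mul,
    add_zero, zero_add, mul_zero, mul_one] at h1 h2 h3
  have h4 := variance_fun_add (hW.memLp_two hp i) (hW.memLp_two hq j)
  rw [h1, h2, h3] at h4
  linarith

end IsBrownianSheet

/-- The increment of `W` over the rectangle `(s₀, s₁] × (t₀, t₁]`. -/
def rectIncrement {Ω : Type*} {d : ℕ} (W : ℝ × ℝ → Ω → EuclideanSpace ℝ (Fin d))
    (s₀ s₁ t₀ t₁ : ℝ) (ω : Ω) : EuclideanSpace ℝ (Fin d) :=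
  W (s₁, t₁) ω - W (s₀, t₁) ω - W (s₁, t₀) ω + W (s₀, t₀) ω

/-- The σ-algebra generated by the sheet on a set of times. -/
abbrev pastSigma {Ω : Type*} {d : ℕ}
    (W : ℝ × ℝ → Ω → EuclideanSpace ℝ (Fin d)) (S : Set (ℝ × ℝ)) : MeasurableSpace Ω :=
  ⨆ q ∈ S, MeasurableSpace.comap (W q) inferInstance

lemma measurable_pastSigma {Ω : Type*} {d : ℕ} (W : ℝ × ℝ → Ω → EuclideanSpace ℝ (Fin d))
    {S : Set (ℝ × ℝ)} {q : ℝ × ℝ} (hq : q ∈ S) : Measurable[pastSigma W S] (W q) :=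
  Measurable.mono (comap_measurable (W q))
    (le_iSup₂ (f := fun q _ => MeasurableSpace.comap (W q) inferInstance) q hq) le_rfl

lemma pastSigma_mono {Ω : Type*} {d : ℕ} (W : ℝ × ℝ → Ω → EuclideanSpace ℝ (Fin d))
    {S T : Set (ℝ × ℝ)} (h : S ⊆ T) : pastSigma W S ≤ pastSigma W T :=
  iSup₂_le fun _ hq => (measurable_pastSigma W (h hq)).comap_le

namespace IsBrownianSheet

variable {Ω : Type*} [mΩ : MeasurableSpace Ω] {P : Measure Ω} [IsProbabilityMeasure P] {d : ℕ}
  {W : ℝ × ℝ → Ω → EuclideanSpace ℝ (Fin d)}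

omit [IsProbabilityMeasure P] in
lemma pastSigma_le (hW : IsBrownianSheet P d W) (S : Set (ℝ × ℝ)) : pastSigma W S ≤ mΩ :=
  iSup₂_le fun q _ => (hW.1 q).comap_le

omit [IsProbabilityMeasure P] in
lemma measurable_rectIncrement (hW : IsBrownianSheet P d W) (s₀ s₁ t₀ t₁ : ℝ) :
    Measurable (rectIncrement W s₀ s₁ t₀ t₁) :=
  (((hW.1 _).sub (hW.1 _)).sub (hW.1 _)).add (hW.1 _)

lemma covariance_rectIncrement_eq_zero (hW : IsBrownianSheet P d W) {q : ℝ × ℝ}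
    (hq : q ∈ Set.Icc (0 : ℝ × ℝ) 1) {s₀ s₁ t₀ t₁ : ℝ} (hs₀ : 0 ≤ s₀) (hs : s₀ ≤ s₁)
    (hs₁ : s₁ ≤ 1) (ht₀ : 0 ≤ t₀) (ht : t₀ ≤ t₁) (ht₁ : t₁ ≤ 1) (h : q.1 ≤ s₀ ∨ q.2 ≤ t₀)
    (i j : Fin d) :
    cov[fun ω => W q ω i, fun ω => rectIncrement W s₀ s₁ t₀ t₁ ω j; P] = 0 := by
  have h11 : (s₁, t₁) ∈ Set.Icc (0 : ℝ × ℝ) 1 := ⟨⟨hs₀.trans hs, ht₀.trans ht⟩, hs₁, ht₁⟩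
  have h01 : (s₀, t₁) ∈ Set.Icc (0 : ℝ × ℝ) 1 := ⟨⟨hs₀, ht₀.trans ht⟩, hs.trans hs₁, ht₁⟩
  have h10 : (s₁, t₀) ∈ Set.Icc (0 : ℝ × ℝ) 1 := ⟨⟨hs₀.trans hs, ht₀⟩, hs₁, ht.trans ht₁⟩
  have h00 : (s₀, t₀) ∈ Set.Icc (0 : ℝ × ℝ) 1 := ⟨⟨hs₀, ht₀⟩, hs.trans hs₁, ht.trans ht₁⟩
  have m := fun {p} (hp : p ∈ Set.Icc (0 : ℝ × ℝ) 1) => hW.memLp_two hp j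
  change cov[_, fun ω => W (s₁, t₁) ω j - W (s₀, t₁) ω j - W (s₁, t₀) ω j + W (s₀, t₀) ω j; P] = 0
  have e : (fun ω => W (s₁, t₁) ω j - W (s₀, t₁) ω j - W (s₁, t₀) ω j + W (s₀, t₀) ω j) =
    (((fun ω => W (s₁, t₁) ω j) - fun ω => W (s₀, t₁) ω j) - fun ω => W (s₁, t₀) ω j) +
      fun ω => W (s₀, t₀) ω j := rfl
  rw [e, covariance_add_right (hW.memLp_two hq i) (((m h11).sub (m h01)).sub (m h10)) (m h00),
    covariance_sub_right (hW.memLp_two hq i) ((m h11).sub (m h01)) (m h10),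
    covariance_sub_right (hW.memLp_two hq i) (m h11) (m h01), hW.covariance_eq hq h11,
    hW.covariance_eq hq h01, hW.covariance_eq hq h10, hW.covariance_eq hq h00]
  split_ifs
  · rcases h with h | h
    · simp [min_eq_left h, min_eq_left (h.trans hs)]
    · simp [min_eq_left h, min_eq_left (h.trans ht)]
  · simp

omit [IsProbabilityMeasure P] in
lemma isGaussianProcess_sum_rectIncrement (hW : IsBrownianSheet P d W) {S : Set (ℝ × ℝ)}
    (hS : S ⊆ Set.Icc 0 1)
    {s₀ s₁ t₀ t₁ : ℝ} (hs₀ : 0 ≤ s₀) (hs : s₀ ≤ s₁)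
    (hs₁ : s₁ ≤ 1) (ht₀ : 0 ≤ t₀) (ht : t₀ ≤ t₁) (ht₁ : t₁ ≤ 1) :
    IsGaussianProcess (Sum.elim (fun (a : S × Fin d) ω => W a.1 ω a.2)
      (fun (j : Fin d) ω => rectIncrement W s₀ s₁ t₀ t₁ ω j)) P := by
  classical
  have h11 : (s₁, t₁) ∈ Set.Icc (0 : ℝ × ℝ) 1 := ⟨⟨hs₀.trans hs, ht₀.trans ht⟩, hs₁, ht₁⟩
  have h01 : (s₀, t₁) ∈ Set.Icc (0 : ℝ × ℝ) 1 := ⟨⟨hs₀, ht₀.trans ht⟩, hs.trans hs₁, ht₁⟩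
  have h10 : (s₁, t₀) ∈ Set.Icc (0 : ℝ × ℝ) 1 := ⟨⟨hs₀.trans hs, ht₀⟩, hs₁, ht.trans ht₁⟩
  have h00 : (s₀, t₀) ∈ Set.Icc (0 : ℝ × ℝ) 1 := ⟨⟨hs₀, ht₀⟩, hs.trans hs₁, ht.trans ht₁⟩
  refine hW.isGaussianProcess.of_isGaussianProcess ?_
  rintro (⟨q, i⟩ | j)
  · exact ⟨{(⟨q, hS q.2⟩, i)}, ContinuousLinearMap.proj ⟨(⟨q, hS q.2⟩, i), by simp⟩,
      fun ω => rfl⟩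
  · refine ⟨{(⟨_, h11⟩, j), (⟨_, h01⟩, j), (⟨_, h10⟩, j), (⟨_, h00⟩, j)},
      ContinuousLinearMap.proj ⟨(⟨_, h11⟩, j), by simp⟩ -
      ContinuousLinearMap.proj ⟨(⟨_, h01⟩, j), by simp⟩ -
      ContinuousLinearMap.proj ⟨(⟨_, h10⟩, j), by simp⟩ +
      ContinuousLinearMap.proj ⟨(⟨_, h00⟩, j), by simp⟩, fun ω => rfl⟩

lemma indep_rectIncrement (hW : IsBrownianSheet P d W) {S : Set (ℝ × ℝ)}
    (hS : S ⊆ Set.Icc 0 1)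
    {s₀ s₁ t₀ t₁ : ℝ} (hs₀ : 0 ≤ s₀) (hs : s₀ ≤ s₁)
    (hs₁ : s₁ ≤ 1) (ht₀ : 0 ≤ t₀) (ht : t₀ ≤ t₁) (ht₁ : t₁ ≤ 1)
    (h : ∀ q ∈ S, q.1 ≤ s₀ ∨ q.2 ≤ t₀) :
    Indep (pastSigma W S)
      (MeasurableSpace.comap (rectIncrement W s₀ s₁ t₀ t₁) inferInstance) P := by
  have key := (hW.isGaussianProcess_sum_rectIncrement hS hs₀ hs hs₁ ht₀ ht
    ht₁).indepFun_of_covariance_eq_zero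
    (fun a => (hW.measurable_coord _ _).aemeasurable)
    (fun j => ((EuclideanSpace.proj (𝕜 := ℝ) j).continuous.measurable.comp
      (hW.measurable_rectIncrement _ _ _ _)).aemeasurable)
    (fun a j => hW.covariance_rectIncrement_eq_zero (hS a.1.2) hs₀ hs hs₁ ht₀ ht ht₁
      (h _ a.1.2) a.2 j)
  have hlp : Measurable (WithLp.toLp 2 : (Fin d → ℝ) → EuclideanSpace ℝ (Fin d)) :=
    (PiLp.continuous_toLp 2 _).measurable
  refine indep_of_indep_of_le_left (indep_of_indep_of_le_right key ?_) ?_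
  · rintro _ ⟨A, hA, rfl⟩
    exact ⟨WithLp.toLp 2 ⁻¹' A, hlp hA, rfl⟩
  · refine iSup₂_le fun q hq => ?_
    rintro _ ⟨A, hA, rfl⟩
    refine ⟨(fun f : S × Fin d → ℝ => WithLp.toLp 2 fun i => f (⟨q, hq⟩, i)) ⁻¹' A,
      (hlp.comp (measurable_pi_lambda _ fun i => measurable_pi_apply _)) hA, rfl⟩

lemma map_rectIncrement (hW : IsBrownianSheet P d W)
    {s₀ s₁ t₀ t₁ : ℝ} (hs₀ : 0 ≤ s₀) (hs : s₀ ≤ s₁)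
    (hs₁ : s₁ ≤ 1) (ht₀ : 0 ≤ t₀) (ht : t₀ ≤ t₁) (ht₁ : t₁ ≤ 1) :
    P.map (rectIncrement W s₀ s₁ t₀ t₁) =
      isoGaussian (EuclideanSpace ℝ (Fin d)) ((s₁ - s₀) * (t₁ - t₀)) := by
  have h11 : (s₁, t₁) ∈ Set.Icc (0 : ℝ × ℝ) 1 := ⟨⟨hs₀.trans hs, ht₀.trans ht⟩, hs₁, ht₁⟩
  have h01 : (s₀, t₁) ∈ Set.Icc (0 : ℝ × ℝ) 1 := ⟨⟨hs₀, ht₀.trans ht⟩, hs.trans hs₁, ht₁⟩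
  have h10 : (s₁, t₀) ∈ Set.Icc (0 : ℝ × ℝ) 1 := ⟨⟨hs₀.trans hs, ht₀⟩, hs₁, ht.trans ht₁⟩
  have h00 : (s₀, t₀) ∈ Set.Icc (0 : ℝ × ℝ) 1 := ⟨⟨hs₀, ht₀⟩, hs.trans hs₁, ht.trans ht₁⟩
  have hv : 0 ≤ (s₁ - s₀) * (t₁ - t₀) := mul_nonneg (sub_nonneg.2 hs) (sub_nonneg.2 ht)
  have hm := hW.measurable_rectIncrement s₀ s₁ t₀ t₁
  have : IsProbabilityMeasure (P.map (rectIncrement W s₀ s₁ t₀ t₁)) :=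
    Measure.isProbabilityMeasure_map hm.aemeasurable
  refine Measure.ext_of_charFun (funext fun x => ?_)
  rw [charFun_isoGaussian hv]
  have hlaw := hW.map_sum (fun a : Fin 4 × Fin d => ![(s₁, t₁), (s₀, t₁), (s₁, t₀), (s₀, t₀)] a.1)
    (fun a => a.2) (fun a => ![1, -1, -1, 1] a.1 * x a.2) (by
      rintro ⟨a, i⟩
      fin_cases a
      exacts [h11, h01, h10, h00])
  have hsum : ∀ ω, inner ℝ (rectIncrement W s₀ s₁ t₀ t₁ ω) x =
      ∑ a : Fin 4 × Fin d, (![1, -1, -1, 1] a.1 * x a.2) *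
        W (![(s₁, t₁), (s₀, t₁), (s₁, t₀), (s₀, t₀)] a.1) ω a.2 := by
    intro ω
    rw [Fintype.sum_prod_type, Fin.sum_univ_four, PiLp.inner_apply, ← Finset.sum_add_distrib,
      ← Finset.sum_add_distrib, ← Finset.sum_add_distrib]
    refine Finset.sum_congr rfl fun i _ => ?_
    simp [rectIncrement]
    ring
  have hvar : (∑ j : Fin 4 × Fin d, ∑ k : Fin 4 × Fin d,
      (![1, -1, -1, 1] j.1 * x j.2) * (![1, -1, -1, 1] k.1 * x k.2) *
      (if j.2 = k.2 then
        min (![(s₁, t₁), (s₀, t₁), (s₁, t₀), (s₀, t₀)] j.1).1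
          (![(s₁, t₁), (s₀, t₁), (s₁, t₀), (s₀, t₀)] k.1).1 *
        min (![(s₁, t₁), (s₀, t₁), (s₁, t₀), (s₀, t₀)] j.1).2
          (![(s₁, t₁), (s₀, t₁), (s₁, t₀), (s₀, t₀)] k.1).2 else 0)) =
      (s₁ - s₀) * (t₁ - t₀) * ‖x‖ ^ 2 := by
    simp only [mul_ite, mul_zero, Fintype.sum_prod_type, Finset.sum_ite_eq, Finset.mem_univ,
      if_true]
    simp only [Fin.sum_univ_four, ← Finset.sum_add_distrib]
    rw [EuclideanSpace.real_norm_sq_eq, Finset.mul_sum]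
    refine Finset.sum_congr rfl fun i _ => ?_
    simp [hs, ht]
    ring
  rw [hvar] at hlaw
  rw [charFun_apply, integral_map hm.aemeasurable (by fun_prop)]
  simp_rw [hsum]
  have hms : Measurable fun ω => ∑ a : Fin 4 × Fin d, (![1, -1, -1, 1] a.1 * x a.2) *
        W (![(s₁, t₁), (s₀, t₁), (s₁, t₀), (s₀, t₀)] a.1) ω a.2 := by
    simp_rw [← hsum]
    fun_prop
  have h1 := charFun_gaussianReal (μ := 0)
    (v := ((s₁ - s₀) * (t₁ - t₀) * ‖x‖ ^ 2).toNNReal) (t := 1)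
  rw [← hlaw, charFun_apply_real, integral_map hms.aemeasurable (by fun_prop)] at h1
  convert h1 using 2
  · simp
  · rw [Real.coe_toNNReal _ (by positivity)]
    push_cast
    ring_nf

end IsBrownianSheet

lemma setIntegral_indep {Ω β E : Type*} {G : MeasurableSpace Ω} [mΩ : MeasurableSpace Ω]
    [MeasurableSpace β] [MeasurableSpace E] {P : Measure Ω} [IsProbabilityMeasure P]
    (hG : G ≤ mΩ) {N : Ω → E} (hN : Measurable N) {γ : Measure E} (hγ : P.map N = γ)
    (hind : Indep G (MeasurableSpace.comap N inferInstance) P) {X : Ω → β}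
    (hX : Measurable[G] X) {B : Set Ω} (hB : MeasurableSet[G] B) {F : β → E → ℝ}
    (hF : Measurable (Function.uncurry F)) {M : ℝ} (hM : ∀ x z, |F x z| ≤ M) :
    ∫ ω in B, F (X ω) (N ω) ∂P = ∫ ω in B, ∫ z, F (X ω) z ∂γ ∂P := by
  have : IsProbabilityMeasure γ := hγ ▸ Measure.isProbabilityMeasure_map hN.aemeasurable
  set Y : Ω → ℝ × β := fun ω => (B.indicator 1 ω, X ω) with hY
  have hYG : Measurable[G] Y :=
    Measurable.prodMk (m := G) (Measurable.indicator (@measurable_const _ _ _ G 1) hB) hX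
  have hYm : Measurable Y := hYG.mono hG le_rfl
  have hYN : IndepFun Y N P := indep_of_indep_of_le_left hind hYG.comap_le
  have hprod := (indepFun_iff_map_prod_eq_prod_map_map hYm.aemeasurable hN.aemeasurable).1 hYN
  have hF' : Measurable fun q : (ℝ × β) × E => q.1.1 * F q.1.2 q.2 :=
    (by fun_prop : Measurable fun q : (ℝ × β) × E => q.1.1).mul
      (hF.comp (by fun_prop : Measurable fun q : (ℝ × β) × E => (q.1.2, q.2)))
  have hYN' : Measurable fun ω => (Y ω, N ω) := hYm.prodMk hN
  have hbd : ∀ ω z, ‖(Y ω).1 * F (Y ω).2 z‖ ≤ M := by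
    intro ω z
    rw [Real.norm_eq_abs, abs_mul]
    have h1 : |(Y ω).1| ≤ 1 := by
      by_cases hω : ω ∈ B <;> simp [hY, hω]
    calc _ ≤ 1 * M := mul_le_mul h1 (hM _ _) (abs_nonneg _) zero_le_one
      _ = M := one_mul M
  have hint : Integrable (fun q : (ℝ × β) × E => q.1.1 * F q.1.2 q.2)
      ((P.map Y).prod (P.map N)) := by
    rw [← hprod, integrable_map_measure hF'.aestronglyMeasurable hYN'.aemeasurable]
    exact Integrable.of_bound (hF'.comp hYN').aestronglyMeasurable M
      (Eventually.of_forall fun ω => hbd _ _)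
  have h1 : ∫ ω, (Y ω).1 * F (Y ω).2 (N ω) ∂P = ∫ ω, ∫ z, (Y ω).1 * F (Y ω).2 z ∂γ ∂P := by
    rw [← integral_map (f := fun q : (ℝ × β) × E => q.1.1 * F q.1.2 q.2) hYN'.aemeasurable
      hF'.aestronglyMeasurable, hprod, integral_prod _ hint, integral_map hYm.aemeasurable, hγ]
    exact hint.1.integral_prod_right'
  rw [← integral_indicator (hG _ hB), ← integral_indicator (hG _ hB)]
  convert h1 using 2
  · ext ω
    by_cases hω : ω ∈ B <;> simp [hY, hω]
  · ext ω
    by_cases hω : ω ∈ B <;> simp [hY, hω]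

section Smoothing

variable {E : Type*} [NormedAddCommGroup E] [InnerProductSpace ℝ E] [FiniteDimensional ℝ E]
  [MeasurableSpace E] [BorelSpace E]

lemma measurable_integral_isoGaussian {f : E → ℝ} (hf : Measurable f) (v : ℝ) :
    Measurable fun w => ∫ z, f (w + z) ∂isoGaussian E v := by
  refine (StronglyMeasurable.integral_prod_right (f := fun w z => f (w + z)) ?_).measurable
  exact (hf.comp measurable_add).stronglyMeasurable

lemma abs_integral_isoGaussian_sub_le {f : E → ℝ} (hf : Measurable f) {M : ℝ}
    (hM : ∀ z, |f z| ≤ M) {v : ℝ} (hv : 0 < v) (x w : E) :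
    |∫ z, f (w + x + z) ∂isoGaussian E v - ∫ z, f (w + z) ∂isoGaussian E v|
      ≤ 2 * M * ‖x‖ * (√v)⁻¹ := by
  have := abs_integral_isoGaussian_shift_le (f := fun z => f (w + z))
    (hf.comp (measurable_const_add w)) (fun z => hM _) hv x
  simpa only [add_right_comm, add_assoc, add_comm x] using this

lemma abs_integral_isoGaussian_diff_le {f : E → ℝ} (hf : Measurable f) {M : ℝ}
    (hM : ∀ z, |f z| ≤ M) {v : ℝ} (hv : 0 < v) (x w : E) :
    |∫ z, (f (w + z) - f (w + z + x)) ∂isoGaussian E v| ≤ 2 * M * ‖x‖ * (√v)⁻¹ := by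
  rw [integral_sub, abs_sub_comm]
  · simpa only [add_right_comm] using abs_integral_isoGaussian_sub_le hf hM hv x w
  · exact Integrable.of_bound (hf.comp (by fun_prop)).aestronglyMeasurable M
      (Eventually.of_forall fun z => hM _)
  · exact Integrable.of_bound (hf.comp (by fun_prop)).aestronglyMeasurable M
      (Eventually.of_forall fun z => hM _)

lemma abs_integral_isoGaussian_diff_mul_le {f h : E → ℝ} (hf : Measurable f) (hh : Measurable h)
    (hf1 : ∀ z, |f z| ≤ 1) {M L : ℝ} (hM : ∀ z, |h z| ≤ M) {v : ℝ} (hv : 0 < v) (x u w : E)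
    (hL : ∀ z, |h (z + x) - h z| ≤ L) :
    |∫ z, (f (u + z) - f (u + z + x)) * h (w + z) ∂isoGaussian E v|
      ≤ 2 * M * ‖x‖ * (√v)⁻¹ + L := by
  have hfh : ∀ a b, |f a * h b| ≤ M := fun a b => by
    rw [abs_mul]
    calc _ ≤ 1 * M := mul_le_mul (hf1 _) (hM _) (abs_nonneg _) zero_le_one
      _ = M := one_mul M
  have hI : ∀ a b : E, Integrable (fun z => f (a + z) * h (b + z)) (isoGaussian E v) := fun a b =>
    Integrable.of_bound (by fun_prop) M (Eventually.of_forall fun z => hfh _ _)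
  have key := abs_integral_isoGaussian_shift_le (f := fun z => f (u + z) * h (w + z))
    (by fun_prop) (fun z => hfh _ _) hv x
  have h2 : |∫ z, f (u + x + z) * (h (w + z + x) - h (w + z)) ∂isoGaussian E v| ≤ L := by
    refine abs_integral_le_of_abs_le fun z => ?_
    rw [abs_mul]
    calc _ ≤ 1 * L := mul_le_mul (hf1 _) (hL _) (abs_nonneg _) zero_le_one
      _ = L := one_mul L
  have h3 : ∫ z, (f (u + z) - f (u + z + x)) * h (w + z) ∂isoGaussian E v =
      -(∫ z, f (u + (z + x)) * h (w + (z + x)) ∂isoGaussian E v -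
        ∫ z, f (u + z) * h (w + z) ∂isoGaussian E v) +
      ∫ z, f (u + x + z) * (h (w + z + x) - h (w + z)) ∂isoGaussian E v := by
    have e1 : (fun z => f (u + (z + x)) * h (w + (z + x))) =
        fun z => f (u + x + z) * h (w + x + z) := by
      ext z; rw [add_comm z x, add_assoc, add_assoc]
    have e2 : (fun z => f (u + x + z) * (h (w + z + x) - h (w + z))) =
        fun z => f (u + x + z) * h (w + x + z) - f (u + x + z) * h (w + z) := by
      ext z; rw [mul_sub, add_right_comm w z x]
    have e3 : (fun z => (f (u + z) - f (u + z + x)) * h (w + z)) =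
        fun z => f (u + z) * h (w + z) - f (u + x + z) * h (w + z) := by
      ext z; rw [sub_mul, add_right_comm u z x]
    rw [e1, e2, e3, integral_sub (hI _ _) (hI _ _), integral_sub (hI _ _) (hI _ _)]
    ring
  rw [h3]
  refine (abs_add_le _ _).trans (add_le_add ?_ h2)
  rw [abs_neg]
  exact key

end Smoothing

lemma abs_setIntegral_le_of_abs_le {Ω : Type*} [MeasurableSpace Ω] {P : Measure Ω}
    [IsFiniteMeasure P] {f : Ω → ℝ} {C : ℝ} (h : ∀ ω, |f ω| ≤ C) (B : Set Ω) :
    |∫ ω in B, f ω ∂P| ≤ C * P.real B := by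
  rw [← Real.norm_eq_abs]
  exact norm_setIntegral_le_of_norm_le_const (measure_lt_top P B) fun ω _ => h ω

lemma inv_sqrt_anti {a b : ℝ} (ha : 0 < a) (hab : a ≤ b) : (√b)⁻¹ ≤ (√a)⁻¹ :=
  inv_anti₀ (Real.sqrt_pos.2 ha) (Real.sqrt_le_sqrt hab)

namespace IsBrownianSheet

variable {Ω : Type*} [mΩ : MeasurableSpace Ω] {P : Measure Ω} [IsProbabilityMeasure P] {d : ℕ}
  {W : ℝ × ℝ → Ω → EuclideanSpace ℝ (Fin d)}

/-- The σ-algebra generated by the sheet on the strip `t ≤ u`. -/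
abbrev _root_.stripSigma {Ω : Type*} {d : ℕ}
    (W : ℝ × ℝ → Ω → EuclideanSpace ℝ (Fin d)) (u : ℝ) : MeasurableSpace Ω :=
  pastSigma W {q | q ∈ Set.Icc (0 : ℝ × ℝ) 1 ∧ q.2 ≤ u}

lemma _root_.stripSigma_mono {Ω : Type*} {d : ℕ} (W : ℝ × ℝ → Ω → EuclideanSpace ℝ (Fin d))
    {u t : ℝ} (h : u ≤ t) : stripSigma W u ≤ stripSigma W t :=
  pastSigma_mono W fun _ hq => ⟨hq.1, hq.2.trans h⟩

lemma setIntegral_rectIncrement (hW : IsBrownianSheet P d W) {S : Set (ℝ × ℝ)}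
    (hS : S ⊆ Set.Icc 0 1)
    {s₀ s₁ t₀ t₁ : ℝ} (hs₀ : 0 ≤ s₀) (hs : s₀ ≤ s₁)
    (hs₁ : s₁ ≤ 1) (ht₀ : 0 ≤ t₀) (ht : t₀ ≤ t₁) (ht₁ : t₁ ≤ 1)
    (h : ∀ q ∈ S, q.1 ≤ s₀ ∨ q.2 ≤ t₀) {β : Type*} [MeasurableSpace β]
    {X : Ω → β} (hX : Measurable[pastSigma W S] X) {B : Set Ω}
    (hB : MeasurableSet[pastSigma W S] B) {F : β → EuclideanSpace ℝ (Fin d) → ℝ}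
    (hF : Measurable (Function.uncurry F)) {M : ℝ} (hM : ∀ x z, |F x z| ≤ M) :
    ∫ ω in B, F (X ω) (rectIncrement W s₀ s₁ t₀ t₁ ω) ∂P =
      ∫ ω in B, ∫ z, F (X ω) z
        ∂isoGaussian (EuclideanSpace ℝ (Fin d)) ((s₁ - s₀) * (t₁ - t₀)) ∂P :=
  setIntegral_indep (hW.pastSigma_le S) (hW.measurable_rectIncrement _ _ _ _)
    (hW.map_rectIncrement hs₀ hs hs₁ ht₀ ht ht₁)
    (hW.indep_rectIncrement hS hs₀ hs hs₁ ht₀ ht ht₁ h) hX hB hF hM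

omit [IsProbabilityMeasure P] in
lemma rectIncrement_zero_left (hW : IsBrownianSheet P d W) {s t₀ t₁ : ℝ} (ht₀ : 0 ≤ t₀)
    (ht : t₀ ≤ t₁) (ht₁ : t₁ ≤ 1) (ω : Ω) :
    rectIncrement W 0 s t₀ t₁ ω = W (s, t₁) ω - W (s, t₀) ω := by
  rw [rectIncrement, hW.2.2.1 ω (0, t₁) ⟨⟨le_rfl, ht₀.trans ht⟩, zero_le_one, ht₁⟩ (Or.inl rfl),
    hW.2.2.1 ω (0, t₀) ⟨⟨le_rfl, ht₀⟩, zero_le_one, ht.trans ht₁⟩ (Or.inl rfl)]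
  simp

/-- Smoothing in the last increment. -/
lemma setIntegral_mul_eq (hW : IsBrownianSheet P d W) {s s' t t' : ℝ} (hs : 0 < s) (hs1 : s ≤ 1)
    (hs' : 0 < s') (hs'1 : s' ≤ 1) (ht : 0 ≤ t) (htt' : t < t') (ht' : t' ≤ 1)
    {g₁ g₂ : EuclideanSpace ℝ (Fin d) → ℝ} (hg₁ : Measurable g₁) (hg₂ : Measurable g₂)
    {M₁ M₂ : ℝ} (hM₁ : ∀ z, |g₁ z| ≤ M₁) (hM₂ : ∀ z, |g₂ z| ≤ M₂) {B : Set Ω}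
    (hB : MeasurableSet[stripSigma W t] B) :
    ∫ ω in B, g₁ (W (s, t) ω) * g₂ (W (s', t') ω) ∂P =
      ∫ ω in B, g₁ (W (s, t) ω) * ∫ z, g₂ (W (s', t) ω + z)
        ∂isoGaussian (EuclideanSpace ℝ (Fin d)) (s' * (t' - t)) ∂P := by
  have hX : Measurable[stripSigma W t] fun ω => (W (s, t) ω, W (s', t) ω) :=
    Measurable.prodMk (m := stripSigma W t)
      (measurable_pastSigma W ⟨⟨⟨hs.le, ht⟩, hs1, htt'.le.trans ht'⟩, le_rfl⟩)
      (measurable_pastSigma W ⟨⟨⟨hs'.le, ht⟩, hs'1, htt'.le.trans ht'⟩, le_rfl⟩)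
  have := hW.setIntegral_rectIncrement (S := {q | q ∈ Set.Icc (0 : ℝ × ℝ) 1 ∧ q.2 ≤ t})
    (fun _ h => h.1) le_rfl hs'.le hs'1 ht htt'.le ht' (fun _ h => Or.inr h.2) hX hB
    (F := fun p z => g₁ p.1 * g₂ (p.2 + z)) (M := M₁ * M₂)
    (by simp only [Function.uncurry_def]; fun_prop)
    (fun p z => by
      rw [abs_mul]
      exact mul_le_mul (hM₁ _) (hM₂ _) (abs_nonneg _) ((abs_nonneg _).trans (hM₁ 0)))
  simp only [integral_const_mul, sub_zero] at this
  rw [← this]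
  refine integral_congr_ae (Eventually.of_forall fun ω => ?_)
  simp only [hW.rectIncrement_zero_left ht htt'.le ht']
  rw [add_sub_cancel]

lemma abs_setIntegral_mul_le_of_gt (hW : IsBrownianSheet P d W) {s s' u t : ℝ}
    (hs1 : s ≤ 1) (hs' : 0 < s') (hss' : s' < s) (hu : 0 ≤ u) (hut : u < t) (ht : t ≤ 1)
    {f h : EuclideanSpace ℝ (Fin d) → ℝ} (hf : Measurable f) (hh : Measurable h)
    (hf1 : ∀ z, |f z| ≤ 1) {M : ℝ} (hM : ∀ z, |h z| ≤ M) (x : EuclideanSpace ℝ (Fin d))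
    {B : Set Ω} (hB : MeasurableSet[stripSigma W u] B) :
    |∫ ω in B, (f (W (s, t) ω) - f (W (s, t) ω + x)) * h (W (s', t) ω) ∂P|
      ≤ 2 * M * ‖x‖ * (√((s - s') * (t - u)))⁻¹ * P.real B := by
  set S : Set (ℝ × ℝ) := {q | q ∈ Set.Icc (0 : ℝ × ℝ) 1 ∧ (q.1 ≤ s' ∨ q.2 ≤ u)} with hS
  have hSt : stripSigma W u ≤ pastSigma W S := pastSigma_mono W fun q hq => ⟨hq.1, Or.inr hq.2⟩
  have hM0 : 0 ≤ M := (abs_nonneg _).trans (hM 0)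
  have hs'1 := hss'.le.trans hs1
  have hs0 := hs'.le.trans hss'.le
  have ht0 := hu.trans hut.le
  have hX : Measurable[pastSigma W S] fun ω =>
      (W (s', t) ω + W (s, u) ω - W (s', u) ω, W (s', t) ω) := by
    have h1 : Measurable[pastSigma W S] (W (s', t)) :=
      measurable_pastSigma W ⟨⟨⟨hs'.le, ht0⟩, hs'1, ht⟩, Or.inl le_rfl⟩
    have h2 : Measurable[pastSigma W S] (W (s, u)) :=
      measurable_pastSigma W ⟨⟨⟨hs0, hu⟩, hs1, hut.le.trans ht⟩, Or.inr le_rfl⟩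
    have h3 : Measurable[pastSigma W S] (W (s', u)) :=
      measurable_pastSigma W ⟨⟨⟨hs'.le, hu⟩, hs'1, hut.le.trans ht⟩, Or.inl le_rfl⟩
    exact Measurable.prodMk (m := pastSigma W S) ((h1.add h2).sub h3) h1
  have key := hW.setIntegral_rectIncrement (S := S) (fun _ h => h.1) hs'.le hss'.le hs1 hu hut.le
    ht (fun _ h => h.2) hX (hSt _ hB)
    (F := fun p z => (f (p.1 + z) - f (p.1 + z + x)) * h p.2) (M := 2 * M)
    (by simp only [Function.uncurry_def]; fun_prop)
    (fun p z => by
      rw [abs_mul]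
      refine mul_le_mul ((abs_sub _ _).trans ?_) (hM _) (abs_nonneg _) zero_le_two
      linarith [hf1 (p.1 + z), hf1 (p.1 + z + x)])
  have e : ∀ ω, W (s', t) ω + W (s, u) ω - W (s', u) ω + rectIncrement W s' s u t ω =
      W (s, t) ω := fun ω => by rw [rectIncrement]; abel
  simp only [e, integral_mul_const] at key
  rw [key]
  refine abs_setIntegral_le_of_abs_le (fun ω => ?_) B
  rw [abs_mul]
  calc _ ≤ 2 * 1 * ‖x‖ * (√((s - s') * (t - u)))⁻¹ * M :=
        mul_le_mul (abs_integral_isoGaussian_diff_le hf hf1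
          (mul_pos (sub_pos.2 hss') (sub_pos.2 hut)) x _) (hM _) (abs_nonneg _) (by positivity)
    _ = _ := by ring

lemma abs_setIntegral_mul_le_of_lt (hW : IsBrownianSheet P d W) {s s' u t : ℝ}
    (hs : 0 < s) (hs'1 : s' ≤ 1) (hss' : s < s') (hu : 0 ≤ u) (hut : u < t) (ht : t ≤ 1)
    {f h : EuclideanSpace ℝ (Fin d) → ℝ} (hf : Measurable f) (hh : Measurable h)
    (hf1 : ∀ z, |f z| ≤ 1) {M : ℝ} (hM : ∀ z, |h z| ≤ M) (x : EuclideanSpace ℝ (Fin d))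
    {B : Set Ω} (hB : MeasurableSet[stripSigma W u] B) :
    |∫ ω in B, (f (W (s, t) ω) - f (W (s, t) ω + x)) * h (W (s', t) ω) ∂P|
      ≤ 2 * M * ‖x‖ * ((√(s * (t - u)))⁻¹ + (√((s' - s) * (t - u)))⁻¹) * P.real B := by
  set S : Set (ℝ × ℝ) := {q | q ∈ Set.Icc (0 : ℝ × ℝ) 1 ∧ (q.1 ≤ s ∨ q.2 ≤ u)} with hS
  have hSt : stripSigma W u ≤ pastSigma W S := pastSigma_mono W fun q hq => ⟨hq.1, Or.inr hq.2⟩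
  have hM0 : 0 ≤ M := (abs_nonneg _).trans (hM 0)
  have hs1 := hss'.le.trans hs'1
  have hs'0 := hs.le.trans hss'.le
  have ht0 := hu.trans hut.le
  have hX : Measurable[pastSigma W S] fun ω =>
      (W (s, t) ω, W (s, t) ω + W (s', u) ω - W (s, u) ω) := by
    have h1 : Measurable[pastSigma W S] (W (s, t)) :=
      measurable_pastSigma W ⟨⟨⟨hs.le, ht0⟩, hs1, ht⟩, Or.inl le_rfl⟩
    have h2 : Measurable[pastSigma W S] (W (s', u)) :=
      measurable_pastSigma W ⟨⟨⟨hs'0, hu⟩, hs'1, hut.le.trans ht⟩, Or.inr le_rfl⟩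
    have h3 : Measurable[pastSigma W S] (W (s, u)) :=
      measurable_pastSigma W ⟨⟨⟨hs.le, hu⟩, hs1, hut.le.trans ht⟩, Or.inl le_rfl⟩
    exact Measurable.prodMk (m := pastSigma W S) h1 ((h1.add h2).sub h3)
  have hg2 : ∀ z, |f z - f (z + x)| ≤ 2 := fun z =>
    (abs_sub _ _).trans (by linarith [hf1 z, hf1 (z + x)])
  have key := hW.setIntegral_rectIncrement (S := S) (fun _ h => h.1) hs.le hss'.le hs'1 hu hut.le
    ht (fun _ h => h.2) hX (hSt _ hB)
    (F := fun p z => (f p.1 - f (p.1 + x)) * h (p.2 + z)) (M := 2 * M)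
    (by simp only [Function.uncurry_def]; fun_prop)
    (fun p z => by
      rw [abs_mul]
      exact mul_le_mul (hg2 _) (hM _) (abs_nonneg _) zero_le_two)
  have e : ∀ ω, W (s, t) ω + W (s', u) ω - W (s, u) ω + rectIncrement W s s' u t ω =
      W (s', t) ω := fun ω => by rw [rectIncrement]; abel
  simp only [e, integral_const_mul] at key
  set H : EuclideanSpace ℝ (Fin d) → ℝ := fun w => ∫ z, h (w + z)
    ∂isoGaussian (EuclideanSpace ℝ (Fin d)) ((s' - s) * (t - u)) with hH
  have hHm : Measurable H := measurable_integral_isoGaussian hh _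
  have hHM : ∀ w, |H w| ≤ M := fun w => abs_integral_le_of_abs_le fun z => hM _
  have hX' : Measurable[stripSigma W u] fun ω => (W (s, u) ω, W (s', u) ω) :=
    Measurable.prodMk (m := stripSigma W u)
      (measurable_pastSigma W ⟨⟨⟨hs.le, hu⟩, hs1, hut.le.trans ht⟩, le_rfl⟩)
      (measurable_pastSigma W ⟨⟨⟨hs'0, hu⟩, hs'1, hut.le.trans ht⟩, le_rfl⟩)
  have key' := hW.setIntegral_rectIncrement (S := {q | q ∈ Set.Icc (0 : ℝ × ℝ) 1 ∧ q.2 ≤ u})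
    (fun _ h => h.1) le_rfl hs.le hs1 hu hut.le ht (fun _ h => Or.inr h.2) hX' hB
    (F := fun p z => (f (p.1 + z) - f (p.1 + z + x)) * H (p.2 + z)) (M := 2 * M)
    (by simp only [Function.uncurry_def]; fun_prop)
    (fun p z => by
      rw [abs_mul]
      exact mul_le_mul (hg2 _) (hHM _) (abs_nonneg _) zero_le_two)
  have e1 : ∀ ω, W (s, u) ω + rectIncrement W 0 s u t ω = W (s, t) ω := fun ω => by
    rw [hW.rectIncrement_zero_left hu hut.le ht]; abel
  have e2 : ∀ ω, W (s', u) ω + rectIncrement W 0 s u t ω =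
      W (s, t) ω + W (s', u) ω - W (s, u) ω := fun ω => by
    rw [hW.rectIncrement_zero_left hu hut.le ht]; abel
  simp only [e1, e2, sub_zero] at key'
  rw [key, key']
  refine abs_setIntegral_le_of_abs_le (fun ω => ?_) B
  refine (abs_integral_isoGaussian_diff_mul_le hf hHm hf1 hHM
    (mul_pos hs (sub_pos.2 hut)) x _ _ fun z => abs_integral_isoGaussian_sub_le hh hM
      (mul_pos (sub_pos.2 hss') (sub_pos.2 hut)) x z).trans (le_of_eq (by ring))

/-- Decorrelation of two spatial differences along the sheet, conditionally on a past strip. -/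
lemma abs_setIntegral_diff_mul_diff_le (hW : IsBrownianSheet P d W) {s s' u t t' : ℝ}
    (hs : 0 < s) (hs1 : s ≤ 1) (hs' : 0 < s') (hs'1 : s' ≤ 1) (hss' : s ≠ s')
    (hu : 0 ≤ u) (hut : u < t) (htt' : t < t') (ht' : t' ≤ 1)
    {f₁ f₂ : EuclideanSpace ℝ (Fin d) → ℝ} (hf₁ : Measurable f₁) (hf₂ : Measurable f₂)
    (hf₁1 : ∀ z, |f₁ z| ≤ 1) (hf₂1 : ∀ z, |f₂ z| ≤ 1) (x : EuclideanSpace ℝ (Fin d))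
    {B : Set Ω} (hB : MeasurableSet[stripSigma W u] B) :
    |∫ ω in B, (f₁ (W (s, t) ω) - f₁ (W (s, t) ω + x)) *
        (f₂ (W (s', t') ω) - f₂ (W (s', t') ω + x)) ∂P|
      ≤ 8 * ‖x‖ ^ 2 * ((√s)⁻¹ * (√(s' - s))⁻¹ + (√s')⁻¹ * (√(s - s'))⁻¹) *
        ((√(t - u))⁻¹ * (√(t' - t))⁻¹) * P.real B := by
  have ht0 := hu.trans hut.le
  have ht1 := htt'.le.trans ht'
  have hdiff : ∀ {f : EuclideanSpace ℝ (Fin d) → ℝ}, (∀ z, |f z| ≤ 1) →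
      ∀ z, |f z - f (z + x)| ≤ 2 := fun hf z =>
    (abs_sub _ _).trans (by linarith [hf z, hf (z + x)])
  rw [hW.setIntegral_mul_eq hs hs1 hs' hs'1 ht0 htt' ht'
    (g₁ := fun z => f₁ z - f₁ (z + x)) (g₂ := fun z => f₂ z - f₂ (z + x)) (by fun_prop)
    (by fun_prop) (hdiff hf₁1) (hdiff hf₂1) (stripSigma_mono W hut.le _ hB)]
  have hv : 0 < s' * (t' - t) := mul_pos hs' (sub_pos.2 htt')
  have hm := measurable_integral_isoGaussian (f := fun z => f₂ z - f₂ (z + x)) (by fun_prop)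
    (s' * (t' - t))
  have hb := fun w => abs_integral_isoGaussian_diff_le hf₂ hf₂1 hv x w
  rcases lt_or_gt_of_ne hss' with h | h
  · refine (hW.abs_setIntegral_mul_le_of_lt hs hs'1 h hu hut ht1 hf₁ hm hf₁1 hb x hB).trans ?_
    refine mul_le_mul_of_nonneg_right ?_ measureReal_nonneg
    rw [Real.sqrt_mul hs'.le, Real.sqrt_mul hs.le, Real.sqrt_mul (sub_pos.2 h).le, mul_inv, mul_inv,
      mul_inv]
    have h1 := inv_sqrt_anti (sub_pos.2 h) (by linarith : s' - s ≤ s')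
    have h2 := inv_sqrt_anti hs h.le
    set α := (√s)⁻¹
    set β := (√s')⁻¹
    set γ := (√(s' - s))⁻¹
    set τ := (√(t - u))⁻¹
    set σ := (√(t' - t))⁻¹
    have : 0 ≤ α := by positivity
    have : 0 ≤ β := by positivity
    have : 0 ≤ γ := by positivity
    have : 0 ≤ β * (√(s - s'))⁻¹ := by positivity
    have h3 : β * (α + γ) ≤ 2 * (α * γ) := by
      nlinarith [mul_le_mul_of_nonneg_left h1 ‹0 ≤ α›, mul_le_mul_of_nonneg_right h2 ‹0 ≤ γ›]
    have hp : 0 ≤ 4 * ‖x‖ ^ 2 * (τ * σ) := by positivity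
    calc _ = 4 * ‖x‖ ^ 2 * (τ * σ) * (β * (α + γ)) := by ring
      _ ≤ 4 * ‖x‖ ^ 2 * (τ * σ) * (2 * (α * γ + β * (√(s - s'))⁻¹)) :=
        mul_le_mul_of_nonneg_left (by linarith) hp
      _ = _ := by ring
  · refine (hW.abs_setIntegral_mul_le_of_gt hs1 hs' h hu hut ht1 hf₁ hm hf₁1 hb x hB).trans ?_
    refine mul_le_mul_of_nonneg_right ?_ measureReal_nonneg
    rw [Real.sqrt_mul hs'.le, Real.sqrt_mul (sub_pos.2 h).le, mul_inv, mul_inv]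
    have h1 : 0 ≤ 8 * ‖x‖ ^ 2 * ((√s)⁻¹ * (√(s' - s))⁻¹) * ((√(t - u))⁻¹ * (√(t' - t))⁻¹) := by
      positivity
    have h2 : 0 ≤ 4 * ‖x‖ ^ 2 * ((√s')⁻¹ * (√(s - s'))⁻¹) * ((√(t - u))⁻¹ * (√(t' - t))⁻¹) := by
      positivity
    linarith

end IsBrownianSheet

lemma lintegral_inv_sqrt_sub_left {a b : ℝ} (hab : a ≤ b) :
    ∫⁻ s in Ioc a b, ENNReal.ofReal (√(s - a))⁻¹ = ENNReal.ofReal (2 * √(b - a)) := by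
  have h1 : ∀ s ∈ Ioc a b, (√(s - a))⁻¹ = (s - a) ^ (-(1 / 2) : ℝ) := fun s hs => by
    rw [Real.sqrt_eq_rpow, Real.rpow_neg (sub_nonneg.2 hs.1.le)]
  have hint : IntervalIntegrable (fun s => (s - a) ^ (-(1 / 2) : ℝ)) volume a b := by
    have := (intervalIntegral.intervalIntegrable_rpow' (a := 0) (b := b - a)
      (r := -(1 / 2)) (by norm_num)).comp_sub_right a
    simpa using this
  rw [setLIntegral_congr_fun measurableSet_Ioc fun s hs => by rw [h1 s hs],
    ← ofReal_integral_eq_lintegral_ofReal ((intervalIntegrable_iff_integrableOn_Ioc_of_le hab).1 hint)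
      ((ae_restrict_iff' measurableSet_Ioc).2 (Eventually.of_forall fun s hs =>
        Real.rpow_nonneg (sub_nonneg.2 hs.1.le) _)),
    ← intervalIntegral.integral_of_le hab,
    intervalIntegral.integral_comp_sub_right (fun s => s ^ (-(1 / 2) : ℝ)), sub_self,
    integral_rpow (Or.inl (by norm_num)), Real.sqrt_eq_rpow]
  congr 1
  rw [show (-(1 / 2) : ℝ) + 1 = 1 / 2 by norm_num, Real.zero_rpow (by norm_num)]
  ring

lemma lintegral_inv_sqrt_sub_le {a b : ℝ} (hab : a ≤ b) (c : ℝ) :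
    ∫⁻ s in Ioc a b, ENNReal.ofReal (√(s - c))⁻¹ ≤ ENNReal.ofReal (2 * √(b - a)) := by
  rcases le_total c a with hca | hac
  · rw [← lintegral_inv_sqrt_sub_left hab]
    refine setLIntegral_mono' measurableSet_Ioc fun s hs => ENNReal.ofReal_le_ofReal ?_
    exact inv_sqrt_anti (sub_pos.2 hs.1) (by linarith)
  · have hsub : Ioc a b ⊆ Ioc a c ∪ Ioc c b := fun s hs => by
      rcases le_or_gt s c with h | h
      · exact Or.inl ⟨hs.1, h⟩
      · exact Or.inr ⟨h, hs.2⟩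
    refine (lintegral_mono_set hsub).trans ((lintegral_union_le _ _ _).trans ?_)
    have h0 : ∫⁻ s in Ioc a c, ENNReal.ofReal (√(s - c))⁻¹ = 0 := by
      rw [setLIntegral_congr_fun (g := fun _ => 0) measurableSet_Ioc fun s hs => by
        simp [Real.sqrt_eq_zero_of_nonpos (sub_nonpos.2 hs.2)]]
      simp
    rw [h0, zero_add]
    rcases le_or_gt c b with hcb | hcb
    · rw [lintegral_inv_sqrt_sub_left hcb]
      exact ENNReal.ofReal_le_ofReal
        (mul_le_mul_of_nonneg_left (Real.sqrt_le_sqrt (by linarith)) zero_le_two)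
    · simp [Ioc_eq_empty_of_le hcb.le]

/-- The symmetric kernel governing the decorrelation of the sheet in each time direction. -/
def sqrtKernel (c s s' : ℝ) : ℝ :=
  (√(s - c))⁻¹ * (√(s' - s))⁻¹ + (√(s' - c))⁻¹ * (√(s - s'))⁻¹

lemma sqrtKernel_nonneg (c s s' : ℝ) : 0 ≤ sqrtKernel c s s' := by
  unfold sqrtKernel; positivity

lemma measurable_sqrtKernel (c : ℝ) : Measurable fun p : ℝ × ℝ => sqrtKernel c p.1 p.2 := by
  unfold sqrtKernel; fun_prop

lemma lintegral_sqrtKernel_le {a b : ℝ} (hab : a ≤ b) (c : ℝ) :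
    ∫⁻ s in Ioc a b, ∫⁻ s' in Ioc a b, ENNReal.ofReal (sqrtKernel c s s')
      ≤ ENNReal.ofReal (8 * (b - a)) := by
  have hm : Measurable fun p : ℝ × ℝ =>
      ENNReal.ofReal (√(p.1 - c))⁻¹ * ENNReal.ofReal (√(p.2 - p.1))⁻¹ := by fun_prop
  have hm' : Measurable fun p : ℝ × ℝ =>
      ENNReal.ofReal (√(p.2 - c))⁻¹ * ENNReal.ofReal (√(p.1 - p.2))⁻¹ := by fun_prop
  have h1 : ∫⁻ s in Ioc a b, ∫⁻ s' in Ioc a b,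
      ENNReal.ofReal (√(s - c))⁻¹ * ENNReal.ofReal (√(s' - s))⁻¹
      ≤ ENNReal.ofReal (4 * (b - a)) := by
    calc _ ≤ ∫⁻ s in Ioc a b,
          ENNReal.ofReal (√(s - c))⁻¹ * ENNReal.ofReal (2 * √(b - a)) := by
          refine lintegral_mono fun s => ?_
          rw [lintegral_const_mul _ (by fun_prop)]
          exact mul_le_mul_right (lintegral_inv_sqrt_sub_le hab s) _
      _ ≤ ENNReal.ofReal (2 * √(b - a)) * ENNReal.ofReal (2 * √(b - a)) := by
          rw [lintegral_mul_const _ (by fun_prop)]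
          exact mul_le_mul_left (lintegral_inv_sqrt_sub_le hab c) _
      _ = _ := by
          rw [← ENNReal.ofReal_mul (by positivity)]
          congr 1
          have := Real.mul_self_sqrt (sub_nonneg.2 hab)
          linear_combination 4 * this
  have h2 : ∀ s s', ENNReal.ofReal (sqrtKernel c s s') =
      ENNReal.ofReal (√(s - c))⁻¹ * ENNReal.ofReal (√(s' - s))⁻¹ +
      ENNReal.ofReal (√(s' - c))⁻¹ * ENNReal.ofReal (√(s - s'))⁻¹ := fun s s' => by
    rw [sqrtKernel, ENNReal.ofReal_add (by positivity) (by positivity),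
      ENNReal.ofReal_mul (by positivity), ENNReal.ofReal_mul (by positivity)]
  simp only [h2]
  have h3 : ∀ s, ∫⁻ s' in Ioc a b,
      (ENNReal.ofReal (√(s - c))⁻¹ * ENNReal.ofReal (√(s' - s))⁻¹ +
      ENNReal.ofReal (√(s' - c))⁻¹ * ENNReal.ofReal (√(s - s'))⁻¹) =
      (∫⁻ s' in Ioc a b, ENNReal.ofReal (√(s - c))⁻¹ * ENNReal.ofReal (√(s' - s))⁻¹) +
      ∫⁻ s' in Ioc a b, ENNReal.ofReal (√(s' - c))⁻¹ * ENNReal.ofReal (√(s - s'))⁻¹ :=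
    fun s => lintegral_add_left (by fun_prop) _
  simp only [h3]
  rw [lintegral_add_left (by exact hm.lintegral_prod_right')]
  have h4 : ∫⁻ s in Ioc a b, ∫⁻ s' in Ioc a b,
      ENNReal.ofReal (√(s' - c))⁻¹ * ENNReal.ofReal (√(s - s'))⁻¹ =
      ∫⁻ s in Ioc a b, ∫⁻ s' in Ioc a b,
      ENNReal.ofReal (√(s - c))⁻¹ * ENNReal.ofReal (√(s' - s))⁻¹ :=
    lintegral_lintegral_swap hm'.aemeasurable
  rw [h4]
  calc _ ≤ ENNReal.ofReal (4 * (b - a)) + ENNReal.ofReal (4 * (b - a)) := add_le_add h1 h1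
    _ = _ := by
      rw [← ENNReal.ofReal_add (by linarith) (by linarith)]
      congr 1; ring

lemma ae_fst_ne_and_snd_ne (p : ℝ × ℝ) : ∀ᵐ q : ℝ × ℝ, p.1 ≠ q.1 ∧ p.2 ≠ q.2 := by
  have h : ∀ c : ℝ, ∀ᵐ s : ℝ, c ≠ s := fun c => by
    simp only [ae_iff, not_not, ne_eq, ofPred_eq_eq_singleton']
    simp
  exact (Measure.quasiMeasurePreserving_fst.ae (h p.1)).and
    (Measure.quasiMeasurePreserving_snd.ae (h p.2))

namespace IsBrownianSheet

variable {Ω : Type*} [mΩ : MeasurableSpace Ω] {P : Measure Ω} [IsProbabilityMeasure P] {d : ℕ}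
  {W : ℝ × ℝ → Ω → EuclideanSpace ℝ (Fin d)}

/-- The spatial difference of `f` along the sheet at time `q`. -/
def _root_.sheetDiff {Ω : Type*} {d : ℕ} (W : ℝ × ℝ → Ω → EuclideanSpace ℝ (Fin d))
    (f : ℝ × ℝ → EuclideanSpace ℝ (Fin d) → ℝ) (x : EuclideanSpace ℝ (Fin d))
    (q : ℝ × ℝ) (ω : Ω) : ℝ :=
  f q (W q ω) - f q (W q ω + x)

lemma _root_.abs_sheetDiff_le {Ω : Type*} {W : ℝ × ℝ → Ω → EuclideanSpace ℝ (Fin d)}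
    {f : ℝ × ℝ → EuclideanSpace ℝ (Fin d) → ℝ} (hf1 : ∀ q z, |f q z| ≤ 1)
    (x : EuclideanSpace ℝ (Fin d)) (q : ℝ × ℝ) (ω : Ω) : |sheetDiff W f x q ω| ≤ 2 :=
  (abs_sub _ _).trans (by linarith [hf1 q (W q ω), hf1 q (W q ω + x)])

omit [IsProbabilityMeasure P] in
lemma measurable_uncurry (hW : IsBrownianSheet P d W) (hWc : ∀ ω, Continuous fun q => W q ω) :
    Measurable (Function.uncurry W) :=
  measurable_uncurry_of_continuous_of_measurable (u := W) hWc hW.1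

lemma _root_.measurable_sheetDiff {Ω : Type*} [MeasurableSpace Ω]
    {W : ℝ × ℝ → Ω → EuclideanSpace ℝ (Fin d)} (hW : Measurable (Function.uncurry W))
    {f : ℝ × ℝ → EuclideanSpace ℝ (Fin d) → ℝ} (hf : Measurable (Function.uncurry f))
    (x : EuclideanSpace ℝ (Fin d)) :
    Measurable (Function.uncurry (sheetDiff W f x)) :=
  (hf.comp (measurable_fst.prodMk hW)).sub (hf.comp (measurable_fst.prodMk (hW.add_const x)))

lemma abs_setIntegral_sheetDiff_mul_le (hW : IsBrownianSheet P d W) {u : ℝ} (hu : 0 ≤ u)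
    {q q' : ℝ × ℝ} (hq1 : 0 < q.1) (hq1' : q.1 ≤ 1) (hq2 : u < q.2) (hq2' : q.2 ≤ 1)
    (hr1 : 0 < q'.1) (hr1' : q'.1 ≤ 1) (hr2 : u < q'.2) (hr2' : q'.2 ≤ 1)
    (h1 : q.1 ≠ q'.1) (h2 : q.2 ≠ q'.2)
    {f : ℝ × ℝ → EuclideanSpace ℝ (Fin d) → ℝ} (hf : Measurable (Function.uncurry f))
    (hf1 : ∀ q z, |f q z| ≤ 1) (x : EuclideanSpace ℝ (Fin d))
    {B : Set Ω} (hB : MeasurableSet[stripSigma W u] B) :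
    |∫ ω in B, sheetDiff W f x q ω * sheetDiff W f x q' ω ∂P| ≤
      8 * ‖x‖ ^ 2 * P.real B * (sqrtKernel 0 q.1 q'.1 * sqrtKernel u q.2 q'.2) := by
  have hm : ∀ q, Measurable (f q) := fun q => hf.of_uncurry_left
  obtain ⟨s, t⟩ := q
  obtain ⟨s', t'⟩ := q'
  dsimp only at *
  have n1 := sqrtKernel_nonneg 0 s s'
  rcases lt_or_gt_of_ne h2 with h | h
  · refine (hW.abs_setIntegral_diff_mul_diff_le hq1 hq1' hr1 hr1' h1 hu hq2 h hr2' (hm (s, t))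
      (hm (s', t')) (hf1 _) (hf1 _) x hB).trans ?_
    have : (√(t - u))⁻¹ * (√(t' - t))⁻¹ ≤ sqrtKernel u t t' :=
      le_add_of_nonneg_right (by positivity)
    calc _ = 8 * ‖x‖ ^ 2 * P.real B *
          (sqrtKernel 0 s s' * ((√(t - u))⁻¹ * (√(t' - t))⁻¹)) := by
          simp only [sqrtKernel, sub_zero]; ring
      _ ≤ _ := by gcongr
  · simp only [mul_comm (sheetDiff W f x (s, t) _)]
    refine (hW.abs_setIntegral_diff_mul_diff_le hr1 hr1' hq1 hq1' h1.symm hu hr2 h hq2'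
      (hm (s', t')) (hm (s, t)) (hf1 _) (hf1 _) x hB).trans ?_
    have : (√(t' - u))⁻¹ * (√(t - t'))⁻¹ ≤ sqrtKernel u t t' :=
      le_add_of_nonneg_left (by positivity)
    calc _ = 8 * ‖x‖ ^ 2 * P.real B *
          (sqrtKernel 0 s s' * ((√(t' - u))⁻¹ * (√(t - t'))⁻¹)) := by
          simp only [sqrtKernel, sub_zero]; ring
      _ ≤ _ := by gcongr

/-- Conditional second moment bound for the integral of a spatial difference over a rectangle. -/
lemma setIntegral_sq_le (hW : IsBrownianSheet P d W) (hWc : ∀ ω, Continuous fun q => W q ω)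
    {α β u v : ℝ} (hα : 0 ≤ α) (hαβ : α ≤ β) (hβ : β ≤ 1) (hu : 0 ≤ u) (huv : u ≤ v) (hv : v ≤ 1)
    {f : ℝ × ℝ → EuclideanSpace ℝ (Fin d) → ℝ} (hf : Measurable (Function.uncurry f))
    (hf1 : ∀ q z, |f q z| ≤ 1) (x : EuclideanSpace ℝ (Fin d))
    {B : Set Ω} (hB : MeasurableSet[stripSigma W u] B) :
    ∫ ω in B, (∫ q in Ioc α β ×ˢ Ioc u v, sheetDiff W f x q ω) ^ 2 ∂P ≤
      512 * ‖x‖ ^ 2 * (β - α) * (v - u) * P.real B := by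
  set R := Ioc α β ×ˢ Ioc u v with hR
  set g := sheetDiff W f x with hg
  have hgm : Measurable (Function.uncurry g) := measurable_sheetDiff (hW.measurable_uncurry hWc) hf x
  have hRm : MeasurableSet R := measurableSet_Ioc.prod measurableSet_Ioc
  have : IsFiniteMeasure (volume.restrict R) := ⟨by
    rw [Measure.restrict_apply_univ, hR, Measure.volume_eq_prod, Measure.prod_prod]
    simp [ENNReal.mul_lt_top_iff]⟩
  have hg2 : ∀ q ω, |g q ω| ≤ 2 := abs_sheetDiff_le hf1 x
  have hAm : Measurable fun ω => ∫ q in R, g q ω :=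
    (StronglyMeasurable.integral_prod_left' (f := Function.uncurry g)
      hgm.stronglyMeasurable).measurable
  set V : ℝ := (volume.restrict R).real univ with hV
  have hAb : ∀ ω, |∫ q in R, g q ω| ≤ 2 * V := fun ω => by
    rw [← Real.norm_eq_abs]
    exact norm_integral_le_of_norm_le_const (Eventually.of_forall fun q => hg2 q ω)
  have hV0 : 0 ≤ V := measureReal_nonneg
  have swap1 : ∫ ω in B, (∫ q in R, g q ω) ^ 2 ∂P =
      ∫ q in R, ∫ ω in B, g q ω * (∫ q' in R, g q' ω) ∂P := by
    simp only [sq, ← integral_mul_const]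
    refine integral_integral_swap (f := fun ω q => g q ω * ∫ q' in R, g q' ω) ?_
    refine Integrable.of_bound (C := 2 * (2 * V)) ?_ (Eventually.of_forall fun p => ?_)
    · exact ((hgm.comp measurable_swap).mul (hAm.comp measurable_fst)).aestronglyMeasurable
    · simp only [Function.uncurry_def, Real.norm_eq_abs, abs_mul]
      exact mul_le_mul (hg2 _ _) (hAb _) (abs_nonneg _) zero_le_two
  have swap2 : ∀ q, ∫ ω in B, g q ω * (∫ q' in R, g q' ω) ∂P =
      ∫ q' in R, ∫ ω in B, g q ω * g q' ω ∂P := fun q => by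
    simp only [← integral_const_mul]
    refine integral_integral_swap (f := fun ω q' => g q ω * g q' ω) ?_
    refine Integrable.of_bound (C := 2 * 2) ?_ (Eventually.of_forall fun p => ?_)
    · exact (((hgm.comp (measurable_const.prodMk measurable_id)).comp measurable_fst).mul
        (hgm.comp measurable_swap)).aestronglyMeasurable
    · simp only [Function.uncurry_def, Real.norm_eq_abs, abs_mul]
      exact mul_le_mul (hg2 _ _) (hg2 _ _) (abs_nonneg _) zero_le_two
  set c : ℝ := 8 * ‖x‖ ^ 2 * P.real B with hc
  have hc0 : 0 ≤ c := by positivity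
  have hrestr : volume.restrict R = (volume.restrict (Ioc α β)).prod (volume.restrict (Ioc u v)) := by
    rw [hR, Measure.volume_eq_prod, Measure.prod_restrict]
  have key : ‖∫ ω in B, (∫ q in R, g q ω) ^ 2 ∂P‖ₑ ≤
      ENNReal.ofReal (512 * ‖x‖ ^ 2 * (β - α) * (v - u) * P.real B) := by
    rw [swap1]
    simp only [swap2]
    calc ‖∫ q in R, ∫ q' in R, ∫ ω in B, g q ω * g q' ω ∂P‖ₑ
        ≤ ∫⁻ q in R, ∫⁻ q' in R, ‖∫ ω in B, g q ω * g q' ω ∂P‖ₑ :=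
          (enorm_integral_le_lintegral_enorm _).trans
            (lintegral_mono fun q => enorm_integral_le_lintegral_enorm _)
      _ ≤ ∫⁻ q in R, ∫⁻ q' in R, ENNReal.ofReal c *
          (ENNReal.ofReal (sqrtKernel 0 q.1 q'.1) * ENNReal.ofReal (sqrtKernel u q.2 q'.2)) := by
          refine setLIntegral_mono' hRm fun q hq => lintegral_mono_ae ?_
          rw [ae_restrict_iff' hRm]
          filter_upwards [ae_fst_ne_and_snd_ne q] with q' hne hq'
          rw [Real.enorm_eq_ofReal_abs, ← ENNReal.ofReal_mul (sqrtKernel_nonneg _ _ _),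
            ← ENNReal.ofReal_mul hc0]
          exact ENNReal.ofReal_le_ofReal (hW.abs_setIntegral_sheetDiff_mul_le hu
            (hα.trans_lt hq.1.1) (hq.1.2.trans hβ) hq.2.1 (hq.2.2.trans hv)
            (hα.trans_lt hq'.1.1) (hq'.1.2.trans hβ) hq'.2.1 (hq'.2.2.trans hv)
            hne.1 hne.2 hf hf1 x hB)
      _ = ENNReal.ofReal c *
          ((∫⁻ s in Ioc α β, ∫⁻ s' in Ioc α β, ENNReal.ofReal (sqrtKernel 0 s s')) *
          ∫⁻ t in Ioc u v, ∫⁻ t' in Ioc u v, ENNReal.ofReal (sqrtKernel u t t')) := by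
          have m : ∀ c, Measurable fun p : ℝ × ℝ => ENNReal.ofReal (sqrtKernel c p.1 p.2) :=
            fun c => (measurable_sqrtKernel c).ennreal_ofReal
          have m' : ∀ c s, Measurable fun s' : ℝ => ENNReal.ofReal (sqrtKernel c s s') :=
            fun c s => (m c).comp (measurable_const.prodMk measurable_id)
          have e : ∀ q : ℝ × ℝ, ∫⁻ q' in R, ENNReal.ofReal c *
              (ENNReal.ofReal (sqrtKernel 0 q.1 q'.1) * ENNReal.ofReal (sqrtKernel u q.2 q'.2)) =
              ENNReal.ofReal c *
              ((∫⁻ s' in Ioc α β, ENNReal.ofReal (sqrtKernel 0 q.1 s')) *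
              ∫⁻ t' in Ioc u v, ENNReal.ofReal (sqrtKernel u q.2 t')) := fun q => by
            rw [lintegral_const_mul' _ _ ENNReal.ofReal_ne_top, hrestr,
              lintegral_prod_mul (m' _ _).aemeasurable (m' _ _).aemeasurable]
          simp only [e]
          have mi : ∀ (c : ℝ) (J : Set ℝ), Measurable fun s : ℝ =>
              ∫⁻ s' in J, ENNReal.ofReal (sqrtKernel c s s') :=
            fun c J => (m c).lintegral_prod_right'
          rw [lintegral_const_mul' _ _ ENNReal.ofReal_ne_top, hrestr,
              lintegral_prod_mul (mi _ _).aemeasurable (mi _ _).aemeasurable]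
      _ ≤ ENNReal.ofReal c * (ENNReal.ofReal (8 * (β - α)) * ENNReal.ofReal (8 * (v - u))) := by
          gcongr
          · exact lintegral_sqrtKernel_le hαβ 0
          · exact lintegral_sqrtKernel_le huv u
      _ = _ := by
          rw [← ENNReal.ofReal_mul (by linarith), ← ENNReal.ofReal_mul hc0]
          congr 1
          rw [hc]; ring
  rw [Real.enorm_eq_ofReal (integral_nonneg fun _ => sq_nonneg _)] at key
  have h1 : 0 ≤ β - α := by linarith
  have h2 : 0 ≤ v - u := by linarith
  exact (ENNReal.ofReal_le_ofReal_iff (by positivity)).1 key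

end IsBrownianSheet

section JohnNirenberg

variable {Ω : Type*}

/-- The event that `|A|` reaches the level `c` for the first time at time `j`. -/
def firstHit (A : ℕ → Ω → ℝ) (c : ℝ) (j : ℕ) : Set Ω :=
  {ω | c ≤ |A j ω| ∧ ∀ i < j, |A i ω| < c}

lemma iUnion_firstHit (A : ℕ → Ω → ℝ) (c : ℝ) (M : ℕ) :
    ⋃ j ∈ Finset.range (M + 1), firstHit A c j = {ω | ∃ j ≤ M, c ≤ |A j ω|} := by
  classical
  ext ω
  simp only [mem_iUnion, Finset.mem_range, Nat.lt_succ_iff, exists_prop, firstHit, mem_ofPred_eq]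
  constructor
  · rintro ⟨j, hj, h, -⟩
    exact ⟨j, hj, h⟩
  · rintro ⟨j, hj, h⟩
    have hex : ∃ j, c ≤ |A j ω| := ⟨j, h⟩
    exact ⟨Nat.find hex, (Nat.find_min' hex h).trans hj, Nat.find_spec hex,
      fun i hi => not_le.1 (Nat.find_min hex hi)⟩

lemma pairwiseDisjoint_firstHit (A : ℕ → Ω → ℝ) (c : ℝ) (s : Set ℕ) :
    s.PairwiseDisjoint (firstHit A c) := by
  intro i _ j _ hij
  refine Set.disjoint_left.2 fun ω hi hj => ?_
  rcases lt_or_gt_of_ne hij with h | h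
  · exact absurd hi.1 (not_le.2 (hj.2 i h))
  · exact absurd hj.1 (not_le.2 (hi.2 j h))

variable [m0 : MeasurableSpace Ω] {μ : Measure Ω} [IsFiniteMeasure μ]
  {F : ℕ → MeasurableSpace Ω} {A : ℕ → Ω → ℝ} {M : ℕ} {a : ℝ}

omit m0 in
lemma measurableSet_firstHit (hF : Monotone F) (hA : ∀ j ≤ M, Measurable[F j] (A j)) (c : ℝ)
    {j : ℕ} (hj : j ≤ M) : MeasurableSet[F j] (firstHit A c j) := by
  have h : ∀ i ≤ j, Measurable[F j] fun ω => |A i ω| := fun i hi =>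
    continuous_abs.measurable.comp ((hA i (hi.trans hj)).mono (hF hi) le_rfl)
  have e : firstHit A c j = {ω | c ≤ |A j ω|} ∩ ⋂ i ∈ Finset.range j, {ω | |A i ω| < c} := by
    ext ω; simp [firstHit]
  rw [e]
  refine MeasurableSet.inter (m := F j) (h j le_rfl measurableSet_Ici) ?_
  exact @Finset.measurableSet_biInter Ω _ (F j) _ _ fun i hi =>
    h i (Finset.mem_range.1 hi).le measurableSet_Iio

lemma measureReal_hit_inter (hF : Monotone F) (hF0 : ∀ j, F j ≤ m0)
    (hA : ∀ j ≤ M, Measurable[F j] (A j)) (c : ℝ) {T : Set Ω} (hT : MeasurableSet T) :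
    μ.real ({ω | ∃ j ≤ M, c ≤ |A j ω|} ∩ T) =
      ∑ j ∈ Finset.range (M + 1), μ.real (firstHit A c j ∩ T) := by
  rw [← iUnion_firstHit, Set.iUnion₂_inter, measureReal_biUnion_finset]
  · exact fun i hi j hj hij => ((pairwiseDisjoint_firstHit A c univ) (mem_univ i) (mem_univ j)
      hij).mono inter_subset_left inter_subset_left
  · exact fun j hj => (hF0 j _ (measurableSet_firstHit hF hA c
      (Nat.lt_succ_iff.1 (Finset.mem_range.1 hj)))).inter hT

/-- A discrete John–Nirenberg inequality. -/
theorem measureReal_exists_le_abs (hF : Monotone F) (hF0 : ∀ j, F j ≤ m0)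
    (hA : ∀ j ≤ M, Measurable[F j] (A j)) (hA0 : ∀ ω, A 0 ω = 0) (ha : 0 < a)
    (hstep : ∀ j < M, ∀ ω, |A (j + 1) ω - A j ω| ≤ a)
    (hcond : ∀ j ≤ M, ∀ B, MeasurableSet[F j] B →
      μ.real (B ∩ {ω | a ≤ |A M ω - A j ω|}) ≤ 1 / 4 * μ.real B) (k : ℕ) :
    μ.real {ω | ∃ j ≤ M, 3 * k * a ≤ |A j ω|} ≤ (1 / 3) ^ k * μ.real univ := by
  have hAm : ∀ j ≤ M, Measurable (A j) := fun j hj => (hA j hj).mono (hF0 j) le_rfl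
  induction k with
  | zero => simpa using measureReal_mono (subset_univ _)
  | succ k ih =>
    set c : ℝ := 3 * k * a with hc
    have hc0 : 0 ≤ c := by positivity
    have hc' : 3 * ((k + 1 : ℕ) : ℝ) * a = c + 3 * a := by rw [hc]; push_cast; ring
    rw [hc']
    set E : Set Ω := {ω | ∃ j ≤ M, c ≤ |A j ω|} with hE
    set E' : Set Ω := {ω | ∃ j ≤ M, c + 3 * a ≤ |A j ω|} with hE'
    set T : Set Ω := {ω | c + 2 * a ≤ |A M ω|} with hT
    have hTm : MeasurableSet T := (hAm M le_rfl).abs measurableSet_Ici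
    have hDm : ∀ j ≤ M, MeasurableSet {ω | a ≤ |A M ω - A j ω|} := fun j hj =>
      ((hAm M le_rfl).sub (hAm j hj)).abs measurableSet_Ici
    have claim1 : μ.real E' ≤ 4 / 3 * μ.real T := by
      have h1 : μ.real E' ≤ 1 / 4 * μ.real E' + μ.real (E' ∩ T) := by
        conv_lhs => rw [← inter_univ E', measureReal_hit_inter hF hF0 hA _ MeasurableSet.univ]
        conv_rhs => rw [← inter_univ E', measureReal_hit_inter hF hF0 hA _ MeasurableSet.univ,
          inter_univ, measureReal_hit_inter hF hF0 hA _ hTm, Finset.mul_sum,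
          ← Finset.sum_add_distrib]
        refine Finset.sum_le_sum fun j hj => ?_
        have hj := Nat.lt_succ_iff.1 (Finset.mem_range.1 hj)
        simp only [inter_univ]
        set H := firstHit A (c + 3 * a) j
        have hsub : H ⊆ (H ∩ {ω | a ≤ |A M ω - A j ω|}) ∪ (H ∩ T) := by
          intro ω hω
          rcases le_or_gt a |A M ω - A j ω| with h | h
          · exact Or.inl ⟨hω, h⟩
          · refine Or.inr ⟨hω, ?_⟩
            have h2 := hω.1
            have h3 := abs_sub_abs_le_abs_sub (A j ω) (A M ω)
            rw [abs_sub_comm] at h3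
            change c + 2 * a ≤ |A M ω|
            linarith
        exact ((measureReal_mono hsub).trans (measureReal_union_le _ _)).trans
          (add_le_add_left (hcond j hj _ (measurableSet_firstHit hF hA _ hj)) _)
      have h2 : μ.real (E' ∩ T) ≤ μ.real T := measureReal_mono inter_subset_right
      linarith
    have claim2 : μ.real T ≤ 1 / 4 * μ.real E := by
      have hTE : E ∩ T = T := inter_eq_right.2 fun ω hω => ⟨M, le_rfl, by
        have : c + 2 * a ≤ |A M ω| := hω
        linarith⟩
      conv_lhs => rw [← hTE, measureReal_hit_inter hF hF0 hA _ hTm]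
      conv_rhs => rw [← inter_univ E, measureReal_hit_inter hF hF0 hA _ MeasurableSet.univ,
        Finset.mul_sum]
      refine Finset.sum_le_sum fun j hj => ?_
      have hj := Nat.lt_succ_iff.1 (Finset.mem_range.1 hj)
      rw [inter_univ]
      refine (measureReal_mono ?_).trans (hcond j hj _ (measurableSet_firstHit hF hA c hj))
      rintro ω ⟨hω, hωT⟩
      refine ⟨hω, ?_⟩
      have hωT : c + 2 * a ≤ |A M ω| := hωT
      have h1 : |A j ω| ≤ c + a := by
        cases j with
        | zero => rw [hA0, abs_zero]; linarith
        | succ i =>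
          have h2 := hω.2 i (Nat.lt_succ_self i)
          have h3 := hstep i hj ω
          have h4 := abs_sub_abs_le_abs_sub (A (i + 1) ω) (A i ω)
          linarith
      have h5 := abs_sub_abs_le_abs_sub (A M ω) (A j ω)
      change a ≤ |A M ω - A j ω|
      linarith
    rw [pow_succ]
    nlinarith [claim1, claim2, ih]

/-- Exponential moment bound obtained from geometrically decaying tails. -/
lemma lintegral_two_pow_floor_le {X : Ω → ℝ} (hX : Measurable X) (hX0 : ∀ ω, 0 ≤ X ω)
    (h : ∀ k : ℕ, μ.real {ω | (k : ℝ) ≤ X ω} ≤ (1 / 3) ^ k * μ.real univ) :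
    ∫⁻ ω, 2 ^ (⌊X ω⌋₊ + 1) ∂μ ≤ 6 * μ univ := by
  have hS : ∀ k : ℕ, MeasurableSet {ω | (k : ℝ) ≤ X ω} := fun k => hX measurableSet_Ici
  calc ∫⁻ ω, 2 ^ (⌊X ω⌋₊ + 1) ∂μ
      ≤ ∫⁻ ω, ∑' k : ℕ, {ω | (k : ℝ) ≤ X ω}.indicator (fun _ => (2 : ENNReal) ^ (k + 1)) ω ∂μ := by
        refine lintegral_mono fun ω => ?_
        refine le_trans ?_ (ENNReal.le_tsum ⌊X ω⌋₊)
        rw [indicator_of_mem (show ω ∈ {η | (⌊X ω⌋₊ : ℝ) ≤ X η} from Nat.floor_le (hX0 ω))]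
    _ = ∑' k : ℕ, 2 ^ (k + 1) * μ {ω | (k : ℝ) ≤ X ω} := by
        rw [lintegral_tsum fun k => (measurable_const.indicator (hS k)).aemeasurable]
        exact tsum_congr fun k => lintegral_indicator_const (hS k) _
    _ ≤ ∑' k : ℕ, ENNReal.ofReal (2 * (2 / 3) ^ k) * μ univ := by
        refine ENNReal.tsum_le_tsum fun k => ?_
        rw [← ofReal_measureReal (μ := μ) (s := {ω | (k : ℝ) ≤ X ω}),
          ← ofReal_measureReal (μ := μ) (s := univ), ← ENNReal.ofReal_mul (by positivity),
          show (2 : ENNReal) ^ (k + 1) = ENNReal.ofReal (2 ^ (k + 1)) by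
            rw [ENNReal.ofReal_pow zero_le_two]; simp, ← ENNReal.ofReal_mul (by positivity)]
        refine ENNReal.ofReal_le_ofReal ?_
        calc _ ≤ (2 : ℝ) ^ (k + 1) * ((1 / 3) ^ k * μ.real univ) :=
              mul_le_mul_of_nonneg_left (h k) (by positivity)
          _ = _ := by rw [div_pow, div_pow, one_pow, pow_succ]; ring
    _ = _ := by
        rw [ENNReal.tsum_mul_right, ← ENNReal.ofReal_tsum_of_nonneg (fun k => by positivity)
          ((summable_geometric_of_lt_one (by norm_num) (by norm_num)).mul_left 2), tsum_mul_left,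
          tsum_geometric_of_lt_one (by norm_num) (by norm_num)]
        norm_num

end JohnNirenberg

lemma lintegral_mul_le_of_setLIntegral_le {Ω : Type*} {m : MeasurableSpace Ω} [m0 : MeasurableSpace Ω]
    {μ : Measure Ω} (hm : m ≤ m0)
    {φ Y : Ω → ENNReal} (hφ : Measurable φ) (hY : Measurable[m] Y) {c : ENNReal}
    (h : ∀ B, MeasurableSet[m] B → ∫⁻ ω in B, φ ω ∂μ ≤ c * μ B) :
    ∫⁻ ω, Y ω * φ ω ∂μ ≤ c * ∫⁻ ω, Y ω ∂μ := by
  have h1 : ∫⁻ ω, Y ω * φ ω ∂μ = ∫⁻ ω, Y ω ∂(μ.withDensity φ) := by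
    rw [lintegral_withDensity_eq_lintegral_mul _ hφ (hY.mono hm le_rfl)]
    simp only [Pi.mul_apply, mul_comm]
  rw [h1, ← lintegral_trim hm hY, ← lintegral_trim hm hY, ← smul_eq_mul, ← lintegral_smul_measure]
  refine lintegral_mono' (Measure.le_iff.2 fun B hB => ?_) le_rfl
  rw [trim_measurableSet_eq hm hB, withDensity_apply _ (hm _ hB), Measure.smul_apply,
    trim_measurableSet_eq hm hB]
  exact h B hB

/-- The integral of `f(q, W_q) - f(q, W_q + x)` over the rectangle `(α, β] × (u, v]`. -/
def sheetIntegral {Ω : Type*} {d : ℕ} (W : ℝ × ℝ → Ω → EuclideanSpace ℝ (Fin d))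
    (f : ℝ × ℝ → EuclideanSpace ℝ (Fin d) → ℝ) (x : EuclideanSpace ℝ (Fin d)) (α β u v : ℝ)
    (ω : Ω) : ℝ :=
  ∫ q in Ioc α β ×ˢ Ioc u v, sheetDiff W f x q ω

lemma volume_real_Ioc_prod_Ioc {α β u v : ℝ} (hαβ : α ≤ β) (huv : u ≤ v) :
    volume.real (Ioc α β ×ˢ Ioc u v) = (β - α) * (v - u) := by
  rw [Measure.volume_eq_prod, measureReal_prod_prod, Real.volume_real_Ioc_of_le hαβ,
    Real.volume_real_Ioc_of_le huv]

lemma volume_Ioc_prod_Ioc_lt_top (α β u v : ℝ) :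
    volume (Ioc α β ×ˢ Ioc u v) < ⊤ :=
  ((Metric.isBounded_Ioc α β).prod (Metric.isBounded_Ioc u v)).measure_lt_top

section Basic

variable {Ω : Type*} {d : ℕ} {W : ℝ × ℝ → Ω → EuclideanSpace ℝ (Fin d)}
  {f : ℝ × ℝ → EuclideanSpace ℝ (Fin d) → ℝ}

lemma measurable_sheetIntegral [MeasurableSpace Ω] (hW : Measurable (Function.uncurry W))
    (hf : Measurable (Function.uncurry f)) (x : EuclideanSpace ℝ (Fin d)) (α β u v : ℝ) :
    Measurable (sheetIntegral W f x α β u v) :=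
  (measurable_sheetDiff hW hf x).stronglyMeasurable.integral_prod_left.measurable

lemma integrableOn_sheetDiff (hWc : ∀ ω, Continuous fun q => W q ω)
    (hf : Measurable (Function.uncurry f)) (hf1 : ∀ q z, |f q z| ≤ 1)
    (x : EuclideanSpace ℝ (Fin d)) (α β u v : ℝ) (ω : Ω) :
    IntegrableOn (fun q => sheetDiff W f x q ω) (Ioc α β ×ˢ Ioc u v) := by
  have hm : Measurable fun q => sheetDiff W f x q ω :=
    (hf.comp (measurable_id.prodMk (hWc ω).measurable)).sub
      (hf.comp (measurable_id.prodMk ((hWc ω).measurable.add_const x)))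
  exact Measure.integrableOn_of_bounded (M := 2) (volume_Ioc_prod_Ioc_lt_top _ _ _ _).ne
    hm.aestronglyMeasurable (ae_of_all _ fun q => abs_sheetDiff_le hf1 x q ω)

lemma sheetIntegral_add (hWc : ∀ ω, Continuous fun q => W q ω)
    (hf : Measurable (Function.uncurry f)) (hf1 : ∀ q z, |f q z| ≤ 1)
    (x : EuclideanSpace ℝ (Fin d)) (α β : ℝ) {u v w : ℝ} (huv : u ≤ v) (hvw : v ≤ w) (ω : Ω) :
    sheetIntegral W f x α β u v ω + sheetIntegral W f x α β v w ω =
      sheetIntegral W f x α β u w ω := by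
  rw [sheetIntegral, sheetIntegral, sheetIntegral, ← Ioc_union_Ioc_eq_Ioc huv hvw, prod_union]
  refine (setIntegral_union ?_ (measurableSet_Ioc.prod measurableSet_Ioc)
    (integrableOn_sheetDiff hWc hf hf1 x _ _ _ _ ω)
    (integrableOn_sheetDiff hWc hf hf1 x _ _ _ _ ω)).symm
  exact Set.disjoint_prod.2 (Or.inr (Ioc_disjoint_Ioc_of_le le_rfl))

lemma abs_sheetIntegral_le (hf1 : ∀ q z, |f q z| ≤ 1)
    (x : EuclideanSpace ℝ (Fin d)) {α β u v : ℝ} (hαβ : α ≤ β) (huv : u ≤ v) (ω : Ω) :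
    |sheetIntegral W f x α β u v ω| ≤ 2 * ((β - α) * (v - u)) := by
  rw [← volume_real_Ioc_prod_Ioc hαβ huv]
  exact norm_setIntegral_le_of_norm_le_const (volume_Ioc_prod_Ioc_lt_top _ _ _ _)
    fun q _ => (Real.norm_eq_abs _).trans_le (abs_sheetDiff_le (W := W) hf1 x q ω)

lemma measurable_stripSigma_sheetIntegral (hWc : ∀ ω, Continuous fun q => W q ω)
    (hf : Measurable (Function.uncurry f)) (x : EuclideanSpace ℝ (Fin d)) {α β u v : ℝ}
    (hα : 0 ≤ α) (hβ : β ≤ 1) (hu : 0 ≤ u) (huv : u ≤ v) (hv : v ≤ 1) :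
    Measurable[stripSigma W v] (sheetIntegral W f x α β u v) := by
  let φ : ℝ × ℝ → ℝ × ℝ := fun q => (max 0 (min q.1 1), max 0 (min q.2 v))
  have hφ : Continuous φ := by fun_prop
  have hφm : ∀ q, φ q ∈ {q | q ∈ Icc (0 : ℝ × ℝ) 1 ∧ q.2 ≤ v} := fun q =>
    ⟨⟨⟨le_max_left _ _, le_max_left _ _⟩, max_le zero_le_one (min_le_right _ _),
      max_le zero_le_one ((min_le_right _ _).trans hv)⟩, max_le (hu.trans huv) (min_le_right _ _)⟩
  have e : sheetIntegral W f x α β u v = sheetIntegral (fun q => W (φ q)) f x α β u v := by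
    funext ω
    refine setIntegral_congr_fun (measurableSet_Ioc.prod measurableSet_Ioc) fun q hq => ?_
    have h : φ q = q := by
      ext
      · change max 0 (min q.1 1) = q.1
        rw [min_eq_left (hq.1.2.trans hβ), max_eq_right (hα.trans hq.1.1.le)]
      · change max 0 (min q.2 v) = q.2
        rw [min_eq_left hq.2.2, max_eq_right (hu.trans hq.2.1.le)]
    simp only [sheetDiff, h]
  rw [e]
  let _ : MeasurableSpace Ω := stripSigma W v
  refine measurable_sheetIntegral ?_ hf x α β u v
  exact measurable_uncurry_of_continuous_of_measurable
    (u := fun q ω => W (φ q) ω) (fun ω => (hWc ω).comp hφ)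
    fun q => measurable_pastSigma W (hφm q)

end Basic

namespace IsBrownianSheet

variable {Ω : Type*} [mΩ : MeasurableSpace Ω] {P : Measure Ω} [IsProbabilityMeasure P] {d : ℕ}
  {W : ℝ × ℝ → Ω → EuclideanSpace ℝ (Fin d)} {f : ℝ × ℝ → EuclideanSpace ℝ (Fin d) → ℝ}
  {α β u v a : ℝ}

lemma measureReal_inter_le (hW : IsBrownianSheet P d W) (hWc : ∀ ω, Continuous fun q => W q ω)
    (hα : 0 ≤ α) (hαβ : α ≤ β) (hβ : β ≤ 1) (hu : 0 ≤ u) (huv : u ≤ v) (hv : v ≤ 1)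
    (hf : Measurable (Function.uncurry f)) (hf1 : ∀ q z, |f q z| ≤ 1)
    (x : EuclideanSpace ℝ (Fin d)) (ha : 0 < a)
    (h : 2048 * ‖x‖ ^ 2 * (β - α) * (v - u) ≤ a ^ 2)
    {B : Set Ω} (hB : MeasurableSet[stripSigma W u] B) :
    P.real (B ∩ {ω | a ≤ |sheetIntegral W f x α β u v ω|}) ≤ 1 / 4 * P.real B := by
  have hB' : MeasurableSet B := hW.pastSigma_le _ _ hB
  have hIm := measurable_sheetIntegral (hW.measurable_uncurry hWc) hf x α β u v
  have hS : MeasurableSet {ω | a ≤ |sheetIntegral W f x α β u v ω|} := hIm.abs measurableSet_Ici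
  have h1 := hW.setIntegral_sq_le hWc hα hαβ hβ hu huv hv hf hf1 x hB
  have hint : Integrable (fun ω => sheetIntegral W f x α β u v ω ^ 2) (P.restrict B) := by
    refine Integrable.of_bound (hIm.pow_const 2).aestronglyMeasurable
      ((2 * ((β - α) * (v - u))) ^ 2) (ae_of_all _ fun ω => ?_)
    rw [norm_pow]
    exact pow_le_pow_left₀ (norm_nonneg _) (abs_sheetIntegral_le hf1 x hαβ huv ω) 2
  have h2 := mul_meas_ge_le_integral_of_nonneg (ae_of_all _ fun ω => sq_nonneg _) hint (a ^ 2)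
  have e : {ω | a ^ 2 ≤ sheetIntegral W f x α β u v ω ^ 2} =
      {ω | a ≤ |sheetIntegral W f x α β u v ω|} := by
    ext ω
    change a ^ 2 ≤ sheetIntegral W f x α β u v ω ^ 2 ↔ a ≤ |sheetIntegral W f x α β u v ω|
    rw [← sq_abs (sheetIntegral W f x α β u v ω), sq_le_sq₀ ha.le (abs_nonneg _)]
  rw [e, measureReal_restrict_apply hS, inter_comm] at h2
  have h3 : a ^ 2 * P.real (B ∩ {ω | a ≤ |sheetIntegral W f x α β u v ω|}) ≤
      a ^ 2 * (1 / 4 * P.real B) := by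
    refine (h2.trans h1).trans ?_
    have := mul_le_mul_of_nonneg_right h (measureReal_nonneg (μ := P) (s := B))
    linarith
  exact le_of_mul_le_mul_left h3 (by positivity)

lemma setLIntegral_two_pow_floor_le (hW : IsBrownianSheet P d W)
    (hWc : ∀ ω, Continuous fun q => W q ω)
    (hα : 0 ≤ α) (hαβ : α ≤ β) (hβ : β ≤ 1) (hu : 0 ≤ u) (huv : u ≤ v) (hv : v ≤ 1)
    (hf : Measurable (Function.uncurry f)) (hf1 : ∀ q z, |f q z| ≤ 1)
    (x : EuclideanSpace ℝ (Fin d)) (ha : 0 < a)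
    (h : 2048 * ‖x‖ ^ 2 * (β - α) * (v - u) ≤ a ^ 2)
    {B : Set Ω} (hB : MeasurableSet[stripSigma W u] B) :
    ∫⁻ ω in B, 2 ^ (⌊|sheetIntegral W f x α β u v ω| / (3 * a)⌋₊ + 1) ∂P ≤ 6 * P B := by
  obtain ⟨M, hM⟩ := exists_nat_gt (2 * ((β - α) * (v - u)) / a)
  have h0 : 0 ≤ (β - α) * (v - u) := mul_nonneg (by linarith) (by linarith)
  have hM0 : (0 : ℝ) < M := lt_of_le_of_lt (by positivity) hM
  have hMa : 2 * ((β - α) * ((v - u) / M)) ≤ a := by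
    rw [div_lt_iff₀ ha] at hM
    rw [← mul_div_assoc, ← mul_div_assoc, div_le_iff₀ hM0]
    linarith
  let t : ℕ → ℝ := fun j => u + j * ((v - u) / M)
  have hl : 0 ≤ (v - u) / M := div_nonneg (by linarith) hM0.le
  have ht : Monotone t := fun i j hij => by
    have : (i : ℝ) ≤ j := Nat.cast_le.2 hij
    change u + i * ((v - u) / M) ≤ u + j * ((v - u) / M)
    gcongr
  have ht0 : t 0 = u := by simp [t]
  have htM : t M = v := by simp only [t]; field_simp; ring
  have hut : ∀ j, u ≤ t j := fun j => ht0 ▸ ht (Nat.zero_le j)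
  have htv : ∀ j ≤ M, t j ≤ v := fun j hj => htM ▸ ht hj
  have hadd : ∀ i j, i ≤ j → ∀ ω, sheetIntegral W f x α β u (t j) ω -
      sheetIntegral W f x α β u (t i) ω = sheetIntegral W f x α β (t i) (t j) ω :=
    fun i j hij ω => by
      rw [← sheetIntegral_add hWc hf hf1 x α β (hut i) (ht hij) ω]; ring
  have hB' : MeasurableSet B := hW.pastSigma_le _ _ hB
  have hJN := measureReal_exists_le_abs (μ := P.restrict B) (F := fun j => stripSigma W (t j))
    (A := fun j => sheetIntegral W f x α β u (t j)) (M := M) (a := a)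
    (fun i j hij => stripSigma_mono W (ht hij)) (fun j => hW.pastSigma_le _)
    (fun j hj => measurable_stripSigma_sheetIntegral hWc hf x hα hβ hu (hut j)
      ((htv j hj).trans hv))
    (fun ω => by simp [sheetIntegral, ht0]) ha
    (fun j hj ω => by
      rw [hadd j (j + 1) (Nat.le_succ j)]
      refine (abs_sheetIntegral_le hf1 x hαβ (ht (Nat.le_succ j)) ω).trans ?_
      rwa [show t (j + 1) - t j = (v - u) / M by simp only [t]; push_cast; ring])
    (fun j hj B₁ hB₁ => by
      have e : ∀ ω, sheetIntegral W f x α β u v ω - sheetIntegral W f x α β u (t j) ω =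
          sheetIntegral W f x α β (t j) v ω := fun ω => by rw [← htM, hadd j M hj]
      simp only [htM, e]
      rw [measureReal_restrict_apply' hB', measureReal_restrict_apply' hB', inter_right_comm]
      refine hW.measureReal_inter_le hWc hα hαβ hβ (hu.trans (hut j)) (htv j hj) hv hf hf1 x ha
        (le_trans ?_ h) (MeasurableSet.inter (m := stripSigma W (t j)) hB₁
          (stripSigma_mono W (hut j) _ hB))
      have : 0 ≤ β - α := by linarith
      gcongr
      exact hut j)
  have key := lintegral_two_pow_floor_le (μ := P.restrict B)
    (X := fun ω => |sheetIntegral W f x α β u v ω| / (3 * a))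
    ((measurable_sheetIntegral (hW.measurable_uncurry hWc) hf x α β u v).abs.div_const _)
    (fun ω => by positivity) (fun k => by
      refine (measureReal_mono fun ω hω => ?_).trans (hJN k)
      refine ⟨M, le_rfl, ?_⟩
      have hω : (k : ℝ) ≤ |sheetIntegral W f x α β u v ω| / (3 * a) := hω
      rw [le_div_iff₀ (by positivity)] at hω
      rw [htM]
      linarith)
  rwa [Measure.restrict_apply_univ] at key

lemma two_pow_mul_measure_le (hW : IsBrownianSheet P d W)
    (hWc : ∀ ω, Continuous fun q => W q ω)
    (hα : 0 ≤ α) (hαβ : α ≤ β) (hβ : β ≤ 1) (hu : 0 ≤ u) (huv : u ≤ v) (hv : v ≤ 1)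
    (hf : Measurable (Function.uncurry f)) (hf1 : ∀ q z, |f q z| ≤ 1)
    (x : EuclideanSpace ℝ (Fin d)) (ha : 0 < a) {N : ℕ} (hN : 0 < N)
    (h : 2048 * ‖x‖ ^ 2 * (β - α) * ((v - u) / N) ≤ a ^ 2) (K : ℕ) :
    2 ^ K * P {ω | 3 * a * K ≤ |sheetIntegral W f x α β u v ω|} ≤ 6 ^ N := by
  have hN0 : (0 : ℝ) < N := Nat.cast_pos.2 hN
  let t : ℕ → ℝ := fun j => u + j * ((v - u) / N)
  have hl : 0 ≤ (v - u) / N := div_nonneg (by linarith) hN0.le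
  have ht : Monotone t := fun i j hij => by
    have : (i : ℝ) ≤ j := Nat.cast_le.2 hij
    change u + i * ((v - u) / N) ≤ u + j * ((v - u) / N)
    gcongr
  have ht0 : t 0 = u := by simp [t]
  have htN : t N = v := by simp only [t]; field_simp; ring
  have hut : ∀ j, u ≤ t j := fun j => ht0 ▸ ht (Nat.zero_le j)
  have htv : ∀ j ≤ N, t j ≤ v := fun j hj => htN ▸ ht hj
  have hts : ∀ j, t (j + 1) - t j = (v - u) / N := fun j => by simp only [t]; push_cast; ring
  let X : ℕ → Ω → ℕ := fun i ω =>
    ⌊|sheetIntegral W f x α β (t i) (t (i + 1)) ω| / (3 * a)⌋₊ + 1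
  have hXm : ∀ i < N, ∀ j, i < j →
      Measurable[stripSigma W (t j)] fun ω => (2 : ENNReal) ^ X i ω := fun i hi j hij =>
    (measurable_from_nat (f := fun n : ℕ => (2 : ENNReal) ^ (n + 1))).comp
      (Nat.measurable_floor.comp ((continuous_abs.measurable.comp
        ((measurable_stripSigma_sheetIntegral hWc hf x hα hβ (hu.trans (hut i))
          (ht (Nat.le_succ i)) ((htv _ hi).trans hv)).mono
          (stripSigma_mono W (ht hij)) le_rfl)).div_const _))
  have hprod : ∀ j ≤ N, ∫⁻ ω, ∏ i ∈ Finset.range j, (2 : ENNReal) ^ X i ω ∂P ≤ 6 ^ j := by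
    intro j
    induction j with
    | zero => simp
    | succ j ih =>
      intro hj
      simp only [Finset.prod_range_succ]
      refine (lintegral_mul_le_of_setLIntegral_le (m := stripSigma W (t j)) (c := 6)
        (hW.pastSigma_le _) ((hXm j hj _ (Nat.lt_succ_self j)).mono (hW.pastSigma_le _) le_rfl)
        ?_ fun B hB => ?_).trans ?_
      · exact @Finset.measurable_fun_prod _ _ _ _ _ _ (stripSigma W (t j)) _ _ fun i hi =>
          hXm i ((Finset.mem_range.1 hi).trans hj) j (Finset.mem_range.1 hi)
      · exact hW.setLIntegral_two_pow_floor_le hWc hα hαβ hβ (hu.trans (hut j))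
          (ht (Nat.le_succ j)) ((htv _ hj).trans hv) hf hf1 x ha (by rwa [hts]) hB
      · rw [pow_succ, mul_comm]
        gcongr
        exact ih (Nat.le_of_succ_le hj)
  have hsum : ∀ j ≤ N, ∀ ω, |sheetIntegral W f x α β u (t j) ω| / (3 * a) ≤
      ∑ i ∈ Finset.range j, (X i ω : ℝ) := by
    intro j
    induction j with
    | zero => intro _ ω; simp [ht0, sheetIntegral]
    | succ j ih =>
      intro hj ω
      rw [Finset.sum_range_succ, ← sheetIntegral_add hWc hf hf1 x α β (hut j) (ht (Nat.le_succ j))]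
      have h1 := (Nat.lt_floor_add_one
        (|sheetIntegral W f x α β (t j) (t (j + 1)) ω| / (3 * a))).le
      have h2 := ih (Nat.le_of_succ_le hj) ω
      have h3 := div_le_div_of_nonneg_right (abs_add_le (sheetIntegral W f x α β u (t j) ω)
        (sheetIntegral W f x α β (t j) (t (j + 1)) ω)) (by positivity : 0 ≤ 3 * a)
      rw [add_div] at h3
      simp only [X, Nat.cast_add, Nat.cast_one] at h1 h2 ⊢
      linarith
  refine le_trans ?_ (hprod N le_rfl)
  refine le_trans ?_ (mul_meas_ge_le_lintegral ?_ (2 ^ K))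
  · gcongr with ω
    intro (hω : 3 * a * K ≤ _)
    rw [Finset.prod_pow_eq_pow_sum]
    refine pow_le_pow_right₀ (by norm_num) ?_
    have h1 := hsum N le_rfl ω
    rw [htN] at h1
    have h2 : (K : ℝ) ≤ |sheetIntegral W f x α β u v ω| / (3 * a) := by
      rw [le_div_iff₀ (by positivity)]; linarith
    exact_mod_cast h2.trans h1
  · exact Finset.measurable_fun_prod _ fun i hi =>
      (hXm i (Finset.mem_range.1 hi) _ (Nat.lt_succ_self i)).mono (hW.pastSigma_le _) le_rfl

/-- Tail estimate for the integrals over a square of side `r`. -/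
theorem measure_abs_sheetIntegral_ge_le (hW : IsBrownianSheet P d W)
    (hWc : ∀ ω, Continuous fun q => W q ω) {r : ℝ} (hr : 0 < r)
    (hα : 0 ≤ α) (hβ : α + r ≤ 1) (hu : 0 ≤ u) (hv : u + r ≤ 1)
    (hf : Measurable (Function.uncurry f)) (hf1 : ∀ q z, |f q z| ≤ 1)
    {x : EuclideanSpace ℝ (Fin d)} {δ : ℝ} (hδ : 0 < δ) (hx : ‖x‖ ≤ δ) {N : ℕ} (hN : 0 < N)
    (κ : ℕ) :
    P {ω | 138 * κ * (δ * r * √N) ≤ |sheetIntegral W f x α (α + r) u (u + r) ω|} ≤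
      ENNReal.ofReal ((6 / 2 ^ κ) ^ N) := by
  have hN0 : (0 : ℝ) < N := Nat.cast_pos.2 hN
  have hs : 0 < √(N : ℝ) := Real.sqrt_pos.2 hN0
  have hs2 : √(N : ℝ) ^ 2 = N := Real.sq_sqrt hN0.le
  have key := hW.two_pow_mul_measure_le hWc hα (by linarith : α ≤ α + r) hβ hu
    (by linarith : u ≤ u + r) hv hf hf1 x (a := 46 * δ * r / √N) (by positivity) hN
    (by
      rw [div_pow, hs2, ← mul_div_assoc, add_sub_cancel_left, add_sub_cancel_left]
      gcongr
      have : ‖x‖ ^ 2 * r ^ 2 ≤ δ ^ 2 * r ^ 2 := by gcongr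
      have h0 : 0 ≤ δ ^ 2 * r ^ 2 := by positivity
      nlinarith) (κ * N)
  rw [show 3 * (46 * δ * r / √(N : ℝ)) * ((κ * N : ℕ) : ℝ) = 138 * κ * (δ * r * √N) by
    push_cast
    field_simp
    rw [hs2]; ring] at key
  rw [div_pow, ← pow_mul, ENNReal.ofReal_div_of_pos (by positivity),
    ENNReal.le_div_iff_mul_le (by simp) (by simp), mul_comm]
  rwa [ENNReal.ofReal_pow (by norm_num), ENNReal.ofReal_pow (by norm_num), ENNReal.ofReal_ofNat,
    ENNReal.ofReal_ofNat]

end IsBrownianSheet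

section Dyadic

variable {d : ℕ}

/-- The vector with coordinates `w i / 2 ^ L`. -/
def dyadicVec (L : ℕ) (w : Fin d → ℤ) : EuclideanSpace ℝ (Fin d) :=
  WithLp.toLp 2 fun i => (w i : ℝ) / 2 ^ L

lemma dyadicVec_apply (L : ℕ) (w : Fin d → ℤ) (i : Fin d) : dyadicVec L w i = w i / 2 ^ L := rfl

lemma dyadicVec_zero (L : ℕ) : dyadicVec L (0 : Fin d → ℤ) = 0 := by
  ext i; simp [dyadicVec_apply]

lemma dyadicVec_add (L : ℕ) (w e : Fin d → ℤ) :
    dyadicVec L (w + e) = dyadicVec L w + dyadicVec L e := by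
  ext i; simp [dyadicVec_apply, add_div]

lemma dyadicVec_succ_two_mul (L : ℕ) (w : Fin d → ℤ) :
    dyadicVec (L + 1) (fun i => 2 * w i) = dyadicVec L w := by
  ext i
  simp only [dyadicVec_apply, pow_succ]
  push_cast
  field_simp

lemma norm_dyadicVec_le (L : ℕ) {e : Fin d → ℤ} (he : ∀ i, |e i| ≤ 1) :
    ‖dyadicVec L e‖ ≤ (d + 1) / 2 ^ L := by
  refine abs_le_of_sq_le_sq' ?_ (by positivity) |>.2
  rw [EuclideanSpace.norm_sq_eq]
  calc ∑ i, ‖dyadicVec L e i‖ ^ 2 ≤ ∑ _i : Fin d, (1 / 2 ^ L : ℝ) ^ 2 := by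
        refine Finset.sum_le_sum fun i _ => ?_
        rw [dyadicVec_apply, norm_div, norm_pow, Real.norm_ofNat, Real.norm_eq_abs]
        gcongr
        exact_mod_cast he i
    _ = d * (1 / 2 ^ L) ^ 2 := by simp
    _ ≤ ((d + 1) / 2 ^ L) ^ 2 := by
        rw [div_pow, div_pow, one_pow, mul_one_div]
        gcongr
        nlinarith [(Nat.cast_nonneg d : (0 : ℝ) ≤ d)]

/-- A dyadic point of the cube of side `2 ^ (-m)` is an integer vector at some scale. -/
lemma IsDyadicPoint.exists_eq_dyadicVec {x : EuclideanSpace ℝ (Fin d)} (hx : IsDyadicPoint x)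
    {m : ℕ} (hm : ∀ i, |x i| ≤ 1 / 2 ^ m) :
    ∃ (L : ℕ) (w : Fin d → ℤ), (∀ i, |w i| ≤ 2 ^ L) ∧ x = dyadicVec (m + L) w := by
  choose c l hcl using hx
  have hl : ∀ i, l i ≤ m + ∑ i, l i := fun i =>
    (Finset.single_le_sum (fun _ _ => Nat.zero_le _) (Finset.mem_univ i)).trans
      (Nat.le_add_left _ _)
  have hw : ∀ i, ((c i * 2 ^ (m + ∑ i, l i - l i) : ℤ) : ℝ) = x i * 2 ^ (m + ∑ i, l i) := by
    intro i
    rw [hcl i, div_mul_eq_mul_div, eq_div_iff (by positivity)]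
    push_cast
    rw [mul_assoc, ← pow_add, Nat.sub_add_cancel (hl i)]
  refine ⟨∑ i, l i, fun i => c i * 2 ^ (m + ∑ i, l i - l i), fun i => ?_, ?_⟩
  · have h : |((c i * 2 ^ (m + ∑ i, l i - l i) : ℤ) : ℝ)| ≤ 2 ^ (∑ i, l i) := by
      rw [hw, abs_mul, abs_of_nonneg (by positivity : (0 : ℝ) ≤ 2 ^ (m + ∑ i, l i)), pow_add,
        ← mul_assoc]
      refine mul_le_of_le_one_left (by positivity) ?_
      rw [← le_div_iff₀ (by positivity)]
      exact hm i
    exact_mod_cast h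
  · ext i
    rw [dyadicVec_apply, hw, mul_div_assoc, div_self (by positivity), mul_one]

lemma exists_scale {x : EuclideanSpace ℝ (Fin d)} (hx : ∀ i, |x i| ≤ 1) (M : ℕ) :
    ∃ m ≤ M, (∀ i, |x i| ≤ 1 / 2 ^ m) ∧ (m = M ∨ 1 / 2 ^ m ≤ 2 * ‖x‖) := by
  induction M with
  | zero => exact ⟨0, le_rfl, by simpa using hx, Or.inl rfl⟩
  | succ M ih =>
    obtain ⟨m, hm, h, rfl | h'⟩ := ih
    · by_cases hM : ∀ i, |x i| ≤ 1 / 2 ^ (m + 1)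
      · exact ⟨m + 1, le_rfl, hM, Or.inl rfl⟩
      · push Not at hM
        obtain ⟨i, hi⟩ := hM
        refine ⟨m, hm.trans (Nat.le_succ _), h, Or.inr ?_⟩
        have h1 : |x i| ≤ ‖x‖ := PiLp.norm_apply_le x i
        have h2 : (1 : ℝ) / 2 ^ m = 2 * (1 / 2 ^ (m + 1)) := by rw [pow_succ]; field_simp
        linarith
    · exact ⟨m, hm.trans (Nat.le_succ _), h, Or.inr h'⟩

lemma exists_eq_two_mul_add {a w : ℤ} (h : |w| ≤ 2 * a) :
    ∃ z e : ℤ, w = 2 * z + e ∧ |z| ≤ a ∧ |e| ≤ 1 := by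
  simp only [abs_le] at h ⊢
  rcases le_total 0 w with hw | hw
  · exact ⟨w / 2, w % 2, by omega, by omega, by omega⟩
  · exact ⟨-(-w / 2), -(-w % 2), by omega, by omega, by omega⟩

/-- Chaining along dyadic scales. -/
lemma abs_le_sum_of_chain {G : EuclideanSpace ℝ (Fin d) → ℝ} (hG : G 0 = 0) {B : ℕ → ℝ} {m : ℕ}
    (h : ∀ j, ∀ z e : Fin d → ℤ, (∀ i, |z i| ≤ 2 ^ j) → (∀ i, |e i| ≤ 1) →
      |G (dyadicVec (m + j) z + dyadicVec (m + j) e) - G (dyadicVec (m + j) z)| ≤ B j)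
    (L : ℕ) (w : Fin d → ℤ) (hw : ∀ i, |w i| ≤ 2 ^ L) :
    |G (dyadicVec (m + L) w)| ≤ ∑ j ∈ Finset.range (L + 1), B j := by
  induction L generalizing w with
  | zero => simpa [dyadicVec_zero, hG] using h 0 0 w (by simp) (by simpa using hw)
  | succ L ih =>
    have hex : ∀ i, ∃ z e : ℤ, w i = 2 * z + e ∧ |z| ≤ 2 ^ L ∧ |e| ≤ 1 := fun i =>
      exists_eq_two_mul_add (by rw [← pow_succ']; exact hw i)
    choose z e hwze hz he using hex
    have hze : w = (fun i => 2 * z i) + e := funext hwze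
    have h1 := ih z hz
    have h2 := h (L + 1) (fun i => 2 * z i) e
      (fun i => by
        rw [abs_mul, pow_succ']
        exact mul_le_mul_of_nonneg_left (hz i) (by norm_num)) he
    have h3 : dyadicVec (m + (L + 1)) (fun i => 2 * z i) = dyadicVec (m + L) z :=
      dyadicVec_succ_two_mul (m + L) z
    rw [← dyadicVec_add, ← hze, h3] at h2
    rw [Finset.sum_range_succ]
    have h4 := abs_sub_abs_le_abs_sub (G (dyadicVec (m + (L + 1)) w))
      (G (dyadicVec (m + L) z))
    linarith

end Dyadic

lemma sum_range_add_two_div_two_pow_le (L : ℕ) :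
    ∑ j ∈ Finset.range L, ((j : ℝ) + 2) / 2 ^ j ≤ 6 := by
  have h : ∑ j ∈ Finset.range L, ((j : ℝ) + 2) / 2 ^ j = 6 - (2 * L + 6) / 2 ^ L := by
    induction L with
    | zero => norm_num
    | succ L ih =>
      rw [Finset.sum_range_succ, ih, pow_succ]
      push_cast
      field_simp
      ring
  rw [h]
  exact sub_le_self _ (by positivity)

lemma ae_bddAbove_of_tsum_ne_top {Ω ι : Type*} [Countable ι] [MeasurableSpace Ω] {P : Measure Ω}
    {Z : ι → Ω → ℝ} {c : ℝ} (h : ∑' i, P {ω | c ≤ Z i ω} ≠ ⊤) :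
    ∀ᵐ ω ∂P, BddAbove (range fun i => Z i ω) := by
  filter_upwards [ae_finite_setOfPred_mem h] with ω hω
  obtain ⟨D, hD⟩ := (hω.image fun i => Z i ω).bddAbove
  refine ⟨max c D, ?_⟩
  rintro _ ⟨i, rfl⟩
  rcases le_or_gt c (Z i ω) with hi | hi
  · exact le_max_of_le_right (hD ⟨i, hi, rfl⟩)
  · exact le_max_of_le_left hi.le

/-- A Brownian sheet agrees on `[0, 1] ^ 2` with one that is continuous on the whole plane. -/
lemma IsBrownianSheet.exists_continuous {Ω : Type*} [MeasurableSpace Ω] {P : Measure Ω} {d : ℕ}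
    {W : ℝ × ℝ → Ω → EuclideanSpace ℝ (Fin d)} (hW : IsBrownianSheet P d W) :
    ∃ V : ℝ × ℝ → Ω → EuclideanSpace ℝ (Fin d), IsBrownianSheet P d V ∧
      (∀ ω, Continuous fun q => V q ω) ∧ ∀ q ∈ Icc (0 : ℝ × ℝ) 1, V q = W q := by
  let φ : ℝ × ℝ → ℝ × ℝ := fun q => (max 0 (min q.1 1), max 0 (min q.2 1))
  have hφ : Continuous φ := by fun_prop
  have hφm : ∀ q, φ q ∈ Icc (0 : ℝ × ℝ) 1 := fun q =>
    ⟨⟨le_max_left _ _, le_max_left _ _⟩,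
      max_le zero_le_one (min_le_right _ _), max_le zero_le_one (min_le_right _ _)⟩
  have hφe : ∀ q ∈ Icc (0 : ℝ × ℝ) 1, φ q = q := fun q hq => by
    obtain ⟨⟨h1, h2⟩, h3, h4⟩ := hq
    simp only [Prod.fst_zero, Prod.snd_zero, Prod.fst_one, Prod.snd_one] at h1 h2 h3 h4
    change (max 0 (min q.1 1), max 0 (min q.2 1)) = q
    rw [min_eq_left h3, max_eq_right h1, min_eq_left h4, max_eq_right h2]
  have he : ∀ q ∈ Icc (0 : ℝ × ℝ) 1, W (φ q) = W q := fun q hq => by rw [hφe q hq]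
  have hc : ∀ ω, Continuous fun q => W (φ q) ω := fun ω =>
    (hW.2.1 ω).comp_continuous hφ hφm
  refine ⟨fun q => W (φ q), ⟨fun q => hW.1 _, fun ω => (hc ω).continuousOn, fun ω p hp h => ?_,
    fun n p idx c hp => ?_⟩, hc, he⟩
  · change W (φ p) ω = 0
    rw [he p hp]; exact hW.2.2.1 ω p hp h
  · rw [← hW.2.2.2 n p idx c hp]
    congr 1
    funext ω
    simp only [he _ (hp _)]

/-- Indices (square, scale, base point, step) of the dyadic increments used at the level `q` of
the chaining. -/
def chainSet (d : ℕ) (q : ℕ × ℕ) : Finset (ℕ × ℕ × ℕ × (Fin d → ℤ) × (Fin d → ℤ)) :=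
  Finset.range (2 ^ q.1) ×ˢ Finset.range (2 ^ q.1) ×ˢ Finset.range (4 ^ q.1 + 1) ×ˢ
    Fintype.piFinset (fun _ => Finset.Icc (-2 ^ q.2) (2 ^ q.2)) ×ˢ
    Fintype.piFinset (fun _ => Finset.Icc (-1) 1)

/-- The normalized dyadic increments. -/
def chainVar {Ω : Type*} {d : ℕ} (W : ℝ × ℝ → Ω → EuclideanSpace ℝ (Fin d))
    (b : ℝ × ℝ → EuclideanSpace ℝ (Fin d) → ℝ) (q : ℕ × ℕ)
    (i : ℕ × ℕ × ℕ × (Fin d → ℤ) × (Fin d → ℤ)) (ω : Ω) : ℝ :=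
  |sheetIntegral W (fun p y => b p (y + dyadicVec (i.2.2.1 + q.2) i.2.2.2.1))
      (dyadicVec (i.2.2.1 + q.2) i.2.2.2.2) (i.2.1 / 2 ^ q.1) (i.2.1 / 2 ^ q.1 + 1 / 2 ^ q.1)
      (i.1 / 2 ^ q.1) (i.1 / 2 ^ q.1 + 1 / 2 ^ q.1) ω| /
    ((d + 1) / 2 ^ (i.2.2.1 + q.2) * (1 / 2 ^ q.1) * √((q.1 + q.2 + 1 : ℕ) : ℝ))

lemma chainVar_nonneg {Ω : Type*} {d : ℕ} (W : ℝ × ℝ → Ω → EuclideanSpace ℝ (Fin d))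
    (b : ℝ × ℝ → EuclideanSpace ℝ (Fin d) → ℝ) (q : ℕ × ℕ)
    (i : ℕ × ℕ × ℕ × (Fin d → ℤ) × (Fin d → ℤ)) (ω : Ω) : 0 ≤ chainVar W b q i ω :=
  div_nonneg (abs_nonneg _) (by positivity)

lemma card_chainSet_le (d : ℕ) (q : ℕ × ℕ) :
    (chainSet d q).card ≤ 2 * 9 ^ d * (16 * 2 ^ d) ^ (q.1 + q.2 + 1) := by
  obtain ⟨n, j⟩ := q
  have h1 : (Finset.Icc (-2 ^ j : ℤ) (2 ^ j)).card = 2 * 2 ^ j + 1 := by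
    rw [Int.card_Icc]
    have : ((2 ^ j : ℕ) : ℤ) = 2 ^ j := by push_cast; rfl
    omega
  have h2 : (Finset.Icc (-1 : ℤ) 1).card = 3 := by simp
  simp only [chainSet, Finset.card_product, Finset.card_range, Fintype.card_piFinset_const, h1, h2]
  have h3 : 2 * 2 ^ j + 1 ≤ 3 * 2 ^ j := by have := Nat.one_le_two_pow (n := j); omega
  have h4 : 4 ^ n + 1 ≤ 2 * 4 ^ n := by have := Nat.one_le_pow n 4 (by norm_num); omega
  calc 2 ^ n * (2 ^ n * ((4 ^ n + 1) * ((2 * 2 ^ j + 1) ^ d * 3 ^ d)))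
      ≤ 2 ^ n * (2 ^ n * ((2 * 4 ^ n) * ((3 * 2 ^ j) ^ d * 3 ^ d))) := by gcongr
    _ = 2 * 9 ^ d * (16 ^ n * (2 ^ d) ^ j) := by
        rw [show 16 = 2 * 2 * 4 by norm_num, show 9 = 3 * 3 by norm_num, mul_pow, mul_pow, mul_pow,
          mul_pow, ← pow_mul, ← pow_mul, mul_comm j d]
        ring
    _ ≤ 2 * 9 ^ d * ((16 * 2 ^ d) ^ n * (16 * 2 ^ d) ^ j) := by
        gcongr
        · exact Nat.le_mul_of_pos_right _ (by positivity)
        · exact Nat.le_mul_of_pos_left _ (by positivity)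
    _ ≤ _ := by
        rw [← pow_add]
        exact Nat.mul_le_mul_left _ (Nat.pow_le_pow_right (by positivity) (Nat.le_succ _))

namespace IsBrownianSheet

variable {Ω : Type*} [mΩ : MeasurableSpace Ω] {P : Measure Ω} [IsProbabilityMeasure P] {d : ℕ}
  {W : ℝ × ℝ → Ω → EuclideanSpace ℝ (Fin d)} {b : ℝ × ℝ → EuclideanSpace ℝ (Fin d) → ℝ}

omit [IsProbabilityMeasure P] in
lemma measurable_chainVar (hW : IsBrownianSheet P d W)
    (hWc : ∀ ω, Continuous fun q => W q ω) (hb : Measurable (Function.uncurry b)) (q : ℕ × ℕ)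
    (i : ℕ × ℕ × ℕ × (Fin d → ℤ) × (Fin d → ℤ)) : Measurable (chainVar W b q i) :=
  (measurable_sheetIntegral (f := fun p y => b p (y + dyadicVec (i.2.2.1 + q.2) i.2.2.2.1))
    (hW.measurable_uncurry hWc) (hb.comp (measurable_fst.prodMk (measurable_snd.add_const _))) _ _ _ _ _).abs.div_const _

lemma measure_chainVar_ge_le (hW : IsBrownianSheet P d W)
    (hWc : ∀ ω, Continuous fun q => W q ω) (hb : Measurable (Function.uncurry b))
    (hb1 : ∀ q z, |b q z| ≤ 1) {q : ℕ × ℕ} {i : ℕ × ℕ × ℕ × (Fin d → ℤ) × (Fin d → ℤ)}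
    (hi : i ∈ chainSet d q) (κ : ℕ) :
    P {ω | 138 * κ ≤ chainVar W b q i ω} ≤ ENNReal.ofReal ((6 / 2 ^ κ) ^ (q.1 + q.2 + 1)) := by
  obtain ⟨n, j⟩ := q
  obtain ⟨k, k', m, z, e⟩ := i
  simp only [chainSet, Finset.mem_product, Finset.mem_range, Fintype.mem_piFinset,
    Finset.mem_Icc] at hi
  obtain ⟨hk, hk', -, -, he⟩ := hi
  have hle : ∀ l : ℕ, l < 2 ^ n → (l : ℝ) / 2 ^ n + 1 / 2 ^ n ≤ 1 := fun l hl => by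
    rw [← add_div, div_le_one (by positivity)]
    exact_mod_cast hl
  refine le_trans (measure_mono fun ω hω => ?_) (hW.measure_abs_sheetIntegral_ge_le hWc (r := 1 / 2 ^ n) (by positivity)
      (α := k' / 2 ^ n) (u := k / 2 ^ n) (by positivity) (hle k' hk') (by positivity) (hle k hk)
      (f := fun p y => b p (y + dyadicVec (m + j) z))
      (hb.comp (measurable_fst.prodMk (measurable_snd.add_const _))) (fun _ _ => hb1 _ _)
      (x := dyadicVec (m + j) e) (δ := (d + 1) / 2 ^ (m + j)) (by positivity)
      (norm_dyadicVec_le _ fun i => abs_le.2 (he i)) (Nat.succ_pos (n + j)) κ)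
  have hω : 138 * κ ≤ chainVar W b (n, j) (k, k', m, z, e) ω := hω
  rw [chainVar, le_div_iff₀ (by positivity)] at hω
  exact hω

lemma ae_bddAbove_chainVar (hW : IsBrownianSheet P d W)
    (hWc : ∀ ω, Continuous fun q => W q ω) (hb : Measurable (Function.uncurry b))
    (hb1 : ∀ q z, |b q z| ≤ 1) :
    ∀ᵐ ω ∂P, BddAbove (range fun p : Σ q, chainSet d q => chainVar W b p.1 p.2 ω) := by
  refine ae_bddAbove_of_tsum_ne_top (c := 138 * (d + 8 : ℕ)) (ne_top_of_le_ne_top (b :=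
    ∑' q : ℕ × ℕ, ENNReal.ofReal (2 * 9 ^ d) *
      (ENNReal.ofReal ((1 / 2) ^ q.1) * ENNReal.ofReal ((1 / 2) ^ q.2))) ?_ ?_)
  · have h : ∑' n : ℕ, ENNReal.ofReal ((1 / 2) ^ n) ≠ ⊤ := by
      rw [← ENNReal.ofReal_tsum_of_nonneg (fun n => by positivity) summable_geometric_two]
      exact ENNReal.ofReal_ne_top
    rw [ENNReal.tsum_mul_left, ENNReal.tsum_prod (f := fun n j =>
      ENNReal.ofReal ((1 / 2) ^ n) * ENNReal.ofReal ((1 / 2) ^ j))]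
    simp only [ENNReal.tsum_mul_left, ENNReal.tsum_mul_right]
    exact ENNReal.mul_ne_top ENNReal.ofReal_ne_top (ENNReal.mul_ne_top h h)
  · rw [ENNReal.tsum_sigma']
    refine ENNReal.tsum_le_tsum fun q => ?_
    calc ∑' i : chainSet d q, P {ω | 138 * ((d + 8 : ℕ) : ℝ) ≤ chainVar W b q i ω}
        ≤ ∑' _i : chainSet d q, ENNReal.ofReal ((6 / 2 ^ (d + 8)) ^ (q.1 + q.2 + 1)) :=
          ENNReal.tsum_le_tsum fun i => hW.measure_chainVar_ge_le hWc hb hb1 i.2 _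
      _ = ENNReal.ofReal ((chainSet d q).card * (6 / 2 ^ (d + 8)) ^ (q.1 + q.2 + 1)) := by
          rw [tsum_fintype, Finset.sum_const, Finset.card_univ, Fintype.card_coe, nsmul_eq_mul,
            ENNReal.ofReal_mul (by positivity), ENNReal.ofReal_natCast]
      _ ≤ _ := by
          rw [← ENNReal.ofReal_mul (by positivity), ← ENNReal.ofReal_mul (by positivity)]
          refine ENNReal.ofReal_le_ofReal ?_
          have h1 : ((chainSet d q).card : ℝ) ≤ 2 * 9 ^ d * (16 * 2 ^ d) ^ (q.1 + q.2 + 1) := by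
            exact_mod_cast card_chainSet_le d q
          calc _ ≤ 2 * 9 ^ d * (16 * 2 ^ d : ℝ) ^ (q.1 + q.2 + 1) *
                (6 / 2 ^ (d + 8)) ^ (q.1 + q.2 + 1) := by gcongr
            _ = 2 * 9 ^ d * (3 / 8) ^ (q.1 + q.2 + 1) := by
                rw [mul_assoc, ← mul_pow, show (16 * 2 ^ d : ℝ) * (6 / 2 ^ (d + 8)) = 3 / 8 by
                  rw [pow_add]; field_simp; norm_num]
            _ ≤ 2 * 9 ^ d * (1 / 2) ^ (q.1 + q.2 + 1) :=
                mul_le_mul_of_nonneg_left (pow_le_pow_left₀ (by norm_num) (by norm_num) _)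
                  (by positivity)
            _ ≤ 2 * 9 ^ d * (1 / 2) ^ (q.1 + q.2) := by
                refine mul_le_mul_of_nonneg_left ?_ (by positivity)
                exact pow_le_pow_of_le_one (by norm_num) (by norm_num) (Nat.le_succ _)
            _ = _ := by rw [pow_add]

end IsBrownianSheet

section Deterministic

variable {Ω : Type*} {d : ℕ} {W : ℝ × ℝ → Ω → EuclideanSpace ℝ (Fin d)}
  {b : ℝ × ℝ → EuclideanSpace ℝ (Fin d) → ℝ}

lemma sheetIntegral_shift (hWc : ∀ ω, Continuous fun q => W q ω)
    (hb : Measurable (Function.uncurry b)) (hb1 : ∀ q z, |b q z| ≤ 1)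
    (y e : EuclideanSpace ℝ (Fin d)) (α β u v : ℝ) (ω : Ω) :
    sheetIntegral W (fun p w => b p (w + y)) e α β u v ω =
      sheetIntegral W b (y + e) α β u v ω - sheetIntegral W b y α β u v ω := by
  rw [sheetIntegral, sheetIntegral, sheetIntegral,
    ← integral_sub (integrableOn_sheetDiff hWc hb hb1 _ _ _ _ _ ω)
      (integrableOn_sheetDiff hWc hb hb1 _ _ _ _ _ ω)]
  refine integral_congr_ae (ae_of_all _ fun q => ?_)
  simp only [sheetDiff, add_assoc, add_comm e y]
  ring

lemma abs_sheetIntegral_le_of_chainVar_le (hWc : ∀ ω, Continuous fun q => W q ω)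
    (hb : Measurable (Function.uncurry b)) (hb1 : ∀ q z, |b q z| ≤ 1) {ω : Ω} {D : ℝ}
    (hD0 : 0 ≤ D) (hD : ∀ q, ∀ i ∈ chainSet d q, chainVar W b q i ω ≤ D)
    {x : EuclideanSpace ℝ (Fin d)} (hx : IsDyadicPoint x) (hx1 : ∀ i, |x i| ≤ 1)
    {n k k' : ℕ} (hn : 1 ≤ n) (hk : k < 2 ^ n) (hk' : k' < 2 ^ n) :
    |sheetIntegral W b x (k' / 2 ^ n) (k' / 2 ^ n + 1 / 2 ^ n) (k / 2 ^ n)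
        (k / 2 ^ n + 1 / 2 ^ n) ω| ≤
      12 * (d + 1) * D * √n * (1 / 2 ^ n) * (‖x‖ + 1 / 2 ^ (4 ^ n)) := by
  obtain ⟨m, hm, hxm, hm'⟩ := exists_scale hx1 (4 ^ n)
  obtain ⟨L, w, hw, rfl⟩ := hx.exists_eq_dyadicVec hxm
  set G : EuclideanSpace ℝ (Fin d) → ℝ := fun y => sheetIntegral W b y (k' / 2 ^ n)
    (k' / 2 ^ n + 1 / 2 ^ n) (k / 2 ^ n) (k / 2 ^ n + 1 / 2 ^ n) ω
  have hn1 : (1 : ℝ) ≤ n := by exact_mod_cast hn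
  have hB := abs_le_sum_of_chain (G := G) (m := m)
    (B := fun j => D * ((d + 1) / 2 ^ m * (1 / 2 ^ n) * √n) * ((j + 2) / 2 ^ j))
    (by simp [G, sheetIntegral, sheetDiff]) (fun j z e hz he => by
      have h1 := hD (n, j) (k, k', m, z, e) (by
        simp only [chainSet, Finset.mem_product, Finset.mem_range, Fintype.mem_piFinset,
          Finset.mem_Icc]
        exact ⟨hk, hk', Nat.lt_succ_of_le hm, fun i => abs_le.1 (hz i), fun i => abs_le.1 (he i)⟩)
      rw [chainVar, div_le_iff₀ (by positivity), sheetIntegral_shift hWc hb hb1] at h1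
      refine h1.trans ?_
      have h2 : √((n + j + 1 : ℕ) : ℝ) ≤ √n * (j + 2) := by
        rw [Real.sqrt_le_left (by positivity), mul_pow, Real.sq_sqrt (by positivity)]
        push_cast
        have hj : (0 : ℝ) ≤ j := Nat.cast_nonneg j
        calc (n : ℝ) + j + 1 ≤ n * (j + 2) := by
              nlinarith [mul_nonneg (sub_nonneg.2 hn1) (add_nonneg hj zero_le_one)]
          _ ≤ n * (j + 2) ^ 2 := by gcongr; nlinarith
      calc _ ≤ D * ((d + 1) / 2 ^ (m + j) * (1 / 2 ^ n) * (√n * (j + 2))) := by gcongr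
        _ = _ := by rw [pow_add]; field_simp) L w hw
  refine hB.trans ?_
  rw [← Finset.mul_sum]
  have h6 := sum_range_add_two_div_two_pow_le (L + 1)
  have hm2 : (1 : ℝ) / 2 ^ m ≤ 2 * (‖dyadicVec (m + L) w‖ + 1 / 2 ^ (4 ^ n)) := by
    have h0 : (0 : ℝ) ≤ 1 / 2 ^ (4 ^ n) := by positivity
    rcases hm' with h | h
    · rw [h] at *
      linarith [norm_nonneg (dyadicVec (4 ^ n + L) w)]
    · linarith
  calc _ ≤ D * ((d + 1) / 2 ^ m * (1 / 2 ^ n) * √n) * 6 := by gcongr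
    _ = 6 * (d + 1) * D * √n * (1 / 2 ^ n) * (1 / 2 ^ m) := by ring
    _ ≤ 6 * (d + 1) * D * √n * (1 / 2 ^ n) *
        (2 * (‖dyadicVec (m + L) w‖ + 1 / 2 ^ (4 ^ n))) := by gcongr
    _ = _ := by ring

end Deterministic

lemma sheetIntegral_eq_integral_integral {Ω : Type*} {d : ℕ}
    {V : ℝ × ℝ → Ω → EuclideanSpace ℝ (Fin d)} (hVc : ∀ ω, Continuous fun q => V q ω)
    {b : ℝ × ℝ → EuclideanSpace ℝ (Fin d) → ℝ} (hb : Measurable (Function.uncurry b))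
    (hb1 : ∀ q z, |b q z| ≤ 1) (x : EuclideanSpace ℝ (Fin d)) (α β u v : ℝ) (ω : Ω) :
    sheetIntegral V b x α β u v ω =
      ∫ s in Ioc α β, ∫ t in Ioc u v, (b (s, t) (V (s, t) ω) - b (s, t) (V (s, t) ω + x)) :=
  setIntegral_prod _ (integrableOn_sheetDiff hVc hb hb1 x _ _ _ _ ω)

/-- a.s. estimate for `ϱ_{nkk'}(0,x)` over dyadic points of `[-1,1]^d`. -/
theorem statement9 {Ω : Type*} [MeasurableSpace Ω] (P : Measure Ω) [IsProbabilityMeasure P]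
    (d : ℕ) (W : ℝ × ℝ → Ω → EuclideanSpace ℝ (Fin d)) (hW : IsBrownianSheet P d W)
    (b : ℝ × ℝ → EuclideanSpace ℝ (Fin d) → ℝ)
    (hmeas : Measurable fun q : (ℝ × ℝ) × EuclideanSpace ℝ (Fin d) => b q.1 q.2)
    (hbdd : ∀ p x, |b p x| ≤ 1) :
    ∃ (Ω₂ : Set Ω) (C₂ : Ω → ℝ), MeasurableSet Ω₂ ∧ P Ω₂ = 1 ∧
      Measurable C₂ ∧ (∀ ω, 0 < C₂ ω) ∧
      ∀ ω ∈ Ω₂, ∀ x : EuclideanSpace ℝ (Fin d),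
        IsDyadicPoint x → (∀ i, |x i| ≤ 1) →
        ∀ n k k' : ℕ, 1 ≤ n → k ≤ 2 ^ n - 1 → k' ≤ 2 ^ n - 1 →
          |∫ s in Set.Ioc ((k' : ℝ) * (2:ℝ) ^ (-(n:ℤ))) (((k' : ℝ) + 1) * (2:ℝ) ^ (-(n:ℤ))),
             ∫ t in Set.Ioc ((k : ℝ) * (2:ℝ) ^ (-(n:ℤ))) (((k : ℝ) + 1) * (2:ℝ) ^ (-(n:ℤ))),
               (b (s, t) (W (s, t) ω) - b (s, t) (W (s, t) ω + x))|
            ≤ C₂ ω * Real.sqrt n * (2:ℝ) ^ (-(n:ℤ)) * (‖x‖ + (2:ℝ) ^ (-(4 ^ n : ℤ))) := by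
  obtain ⟨V, hV, hVc, hVW⟩ := hW.exists_continuous
  have hb : Measurable (Function.uncurry b) := hmeas
  let Z : (Σ q, chainSet d q) → Ω → ℝ := fun p => chainVar V b p.1 p.2
  obtain ⟨D, hD⟩ : ∃ D : Ω → ℝ, D = fun ω => ⨆ p, Z p ω := ⟨_, rfl⟩
  have hDm : Measurable D := by
    rw [hD]
    exact Measurable.iSup fun p => hV.measurable_chainVar hVc hb p.1 p.2
  have hD0 : ∀ ω, 0 ≤ D ω := fun ω => by
    rw [hD]
    exact Real.iSup_nonneg fun p => chainVar_nonneg V b p.1 p.2 ω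
  obtain ⟨Ω₂, hΩ₂, hm, hΩ₂D⟩ := (hV.ae_bddAbove_chainVar hVc hb hbdd).exists_measurable_mem
  have hDZ : ∀ ω ∈ Ω₂, ∀ p, Z p ω ≤ 1 + D ω := fun ω hω p => by
    rw [hD]
    exact (le_ciSup (hΩ₂D ω hω) p).trans (by linarith)
  refine ⟨Ω₂, fun ω => 12 * (d + 1) * (1 + D ω), hm, (mem_ae_iff_prob_eq_one hm).1 hΩ₂,
    (hDm.const_add 1).const_mul _,
    fun ω => mul_pos (by positivity) (by linarith [hD0 ω]), ?_⟩
  intro ω hω x hx hx1 n k k' hn hk hk'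
  have hpos : 0 < 2 ^ n := Nat.two_pow_pos n
  have hle : ∀ l : ℕ, l < 2 ^ n → (l : ℝ) / 2 ^ n + 1 / 2 ^ n ≤ 1 := fun l hl => by
    rw [← add_div, div_le_one (by positivity)]
    exact_mod_cast hl
  have hk₁ : k < 2 ^ n := by omega
  have hk₂ : k' < 2 ^ n := by omega
  have hl : ∀ l : ℕ, (l : ℝ) * (2 : ℝ) ^ (-(n : ℤ)) = l / 2 ^ n := fun l => by
    rw [zpow_neg, zpow_natCast, div_eq_mul_inv]
  have hr : ∀ l : ℕ, ((l : ℝ) + 1) * (2 : ℝ) ^ (-(n : ℤ)) = l / 2 ^ n + 1 / 2 ^ n := fun l => by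
    rw [zpow_neg, zpow_natCast, ← div_eq_mul_inv, add_div]
  have key := abs_sheetIntegral_le_of_chainVar_le hVc hb hbdd (D := 1 + D ω)
    (by linarith [hD0 ω]) (fun q i hi =>
      hDZ ω hω ⟨q, i, hi⟩)
    hx hx1 hn hk₁ hk₂
  rw [sheetIntegral_eq_integral_integral hVc hb hbdd, setIntegral_congr_fun measurableSet_Ioc
    fun s hs => setIntegral_congr_fun measurableSet_Ioc fun t ht => by
      have hs0 : 0 ≤ s := le_trans (by positivity) hs.1.le
      have ht0 : 0 ≤ t := le_trans (by positivity) ht.1.le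
      beta_reduce
      rw [hVW (s, t) ⟨⟨hs0, ht0⟩, hs.2.trans (hle k' hk₂), ht.2.trans (hle k hk₁)⟩]] at key
  rw [hl, hl, hr, hr]
  refine key.trans_eq ?_
  have e4 : (2 : ℝ) ^ (-(4 ^ n : ℤ)) = 1 / 2 ^ (4 ^ n) := by
    rw [zpow_neg, one_div, ← zpow_natCast]
    norm_cast
  rw [e4, zpow_neg, zpow_natCast, one_div (2 ^ n : ℝ)]
end
end

section
/- Let w : [0,1]^2 → ℝ^d be a continuous function and let b : [0,1]^2 × ℝ^d → ℝ be Borel measurable with |b(s,t,x)| ≤ 1 everywhere and with b(s,t,·) componentwise nondecreasing for every (s,t). Let C₁ > 0 and suppose that for all dyadic points x, y ∈ [−1,1]^d and all integers n ≥ 1, 0 ≤ k, k' ≤ 2^n − 1 one has |ϱ^w_{nkk'}(x,y)| ≤ C₁ 2^{−n} [ √n + (log⁺(1/|x−y|))^{1/2} ] |x−y|. Then the same bound |ϱ^w_{nkk'}(x,y)| ≤ C₁ 2^{−n} [ √n + (log⁺(1/|x−y|))^{1/2} ] |x−y| holds for all (not necessarily dyadic) x, y ∈ [−1,1]^d and all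 such n, k, k'. -/
open MeasureTheory Set

noncomputable section

open Filter Topology

/-- Every point of `[-1,1]^d` is the limit of dyadic points of `[-1,1]^d` lying above it. -/
theorem exists_dyadic_seq_ge {d : ℕ} (x : EuclideanSpace ℝ (Fin d)) (hx : ∀ i, |x i| ≤ 1) :
    ∃ u : ℕ → EuclideanSpace ℝ (Fin d), (∀ m, IsDyadicPoint (u m)) ∧ (∀ m i, |u m i| ≤ 1) ∧
      (∀ m i, x i ≤ u m i) ∧ Tendsto u atTop (𝓝 x) := by
  have hle : ∀ (m : ℕ) (i : Fin d), x i ≤ (⌈x i * 2 ^ m⌉ : ℝ) / 2 ^ m := fun m i => by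
    rw [le_div_iff₀ (by positivity)]
    exact Int.le_ceil _
  refine ⟨fun m => WithLp.toLp 2 fun i => (⌈x i * 2 ^ m⌉ : ℝ) / 2 ^ m,
    fun m i => ⟨⌈x i * 2 ^ m⌉, m, rfl⟩, fun m i => ?_, hle, ?_⟩
  · obtain ⟨h₁, h₂⟩ := abs_le.1 (hx i)
    refine abs_le.2 ⟨h₁.trans (hle m i), ?_⟩
    change (⌈x i * 2 ^ m⌉ : ℝ) / 2 ^ m ≤ 1
    rw [div_le_one (by positivity)]
    have h : ⌈x i * 2 ^ m⌉ ≤ (2 : ℤ) ^ m := by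
      rw [Int.ceil_le]
      push_cast
      exact mul_le_of_le_one_left (by positivity) h₂
    exact_mod_cast h
  · have hcoord : Tendsto (fun (m : ℕ) (i : Fin d) => (⌈x i * 2 ^ m⌉ : ℝ) / 2 ^ m) atTop
        (𝓝 (WithLp.ofLp x)) := by
      refine tendsto_pi_nhds.2 fun i => ?_
      have hlim : Tendsto (fun m : ℕ => x i + (1 / 2 : ℝ) ^ m) atTop (𝓝 (x i)) := by
        simpa using (tendsto_pow_atTop_nhds_zero_of_lt_one (r := (1 / 2 : ℝ)) (by norm_num)
          (by norm_num)).const_add (x i)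
      refine tendsto_of_tendsto_of_tendsto_of_le_of_le tendsto_const_nhds hlim
        (fun m => hle m i) fun m => ?_
      change (⌈x i * 2 ^ m⌉ : ℝ) / 2 ^ m ≤ x i + (1 / 2) ^ m
      rw [div_le_iff₀ (by positivity), add_mul, ← mul_pow]
      norm_num
      exact (Int.ceil_lt_add_one _).le
    exact ((PiLp.continuous_toLp 2 _).tendsto _).comp hcoord

/-- Every point of `[-1,1]^d` is the limit of dyadic points of `[-1,1]^d` lying below it. -/
theorem exists_dyadic_seq_le {d : ℕ} (x : EuclideanSpace ℝ (Fin d)) (hx : ∀ i, |x i| ≤ 1) :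
    ∃ u : ℕ → EuclideanSpace ℝ (Fin d), (∀ m, IsDyadicPoint (u m)) ∧ (∀ m i, |u m i| ≤ 1) ∧
      (∀ m i, u m i ≤ x i) ∧ Tendsto u atTop (𝓝 x) := by
  obtain ⟨u, hdy, hcube, hge, hlim⟩ := exists_dyadic_seq_ge (-x) (by simpa using hx)
  refine ⟨fun m => -u m, fun m i => ?_, by simpa using hcube, fun m i => ?_, by
    simpa using hlim.neg⟩
  · obtain ⟨a, l, h⟩ := hdy m i
    exact ⟨-a, l, by simp [h, neg_div]⟩
  · have := hge m i
    simp only [PiLp.neg_apply] at this ⊢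
    linarith

/-- Iterated integrals over sets of finite measure are monotone on bounded measurable functions. -/
theorem iterated_setIntegral_mono {f g : ℝ × ℝ → ℝ} (hf : Measurable f) (hg : Measurable g)
    {M : ℝ} (hfM : ∀ p, |f p| ≤ M) (hgM : ∀ p, |g p| ≤ M) (hfg : ∀ p, f p ≤ g p) {A B : Set ℝ}
    (hA : volume A ≠ ⊤) (hB : volume B ≠ ⊤) :
    ∫ s in A, ∫ t in B, f (s, t) ≤ ∫ s in A, ∫ t in B, g (s, t) := by
  have : IsFiniteMeasure (volume.restrict A) := ⟨by simpa using hA.lt_top⟩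
  have : IsFiniteMeasure (volume.restrict B) := ⟨by simpa using hB.lt_top⟩
  have hint : ∀ {h : ℝ × ℝ → ℝ}, Measurable h → (∀ p, |h p| ≤ M) →
      (∀ s, IntegrableOn (fun t => h (s, t)) B) ∧ IntegrableOn (fun s => ∫ t in B, h (s, t)) A := by
    intro h hm hM
    refine ⟨fun s => Integrable.of_bound
      (hm.comp measurable_prodMk_left).aestronglyMeasurable M (ae_of_all _ fun t => hM _), ?_⟩
    have hprod : Integrable h ((volume.restrict A).prod (volume.restrict B)) :=
      Integrable.of_bound hm.aestronglyMeasurable M (ae_of_all _ hM)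
    exact hprod.integral_prod_left
  exact integral_mono (hint hf hfM).2 (hint hg hgM).2 fun s =>
    integral_mono ((hint hf hfM).1 s) ((hint hg hgM).1 s) fun t => hfg (s, t)

/-- The dyadic intervals of level `n` are contained in `[0,1]`. -/
theorem dyadic_Ioc_subset_Icc {n k : ℕ} (hk : k ≤ 2 ^ n - 1) :
    Ioc ((k : ℝ) * (2:ℝ) ^ (-(n:ℤ))) (((k : ℝ) + 1) * (2:ℝ) ^ (-(n:ℤ))) ⊆ Icc 0 1 := by
  have hk' : (k : ℝ) + 1 ≤ 2 ^ n := by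
    have : k + 1 ≤ 2 ^ n := by have := Nat.one_le_two_pow (n := n); omega
    exact_mod_cast this
  refine fun t ht => ⟨le_trans (by positivity) ht.1.le, ht.2.trans ?_⟩
  rw [zpow_neg, zpow_natCast, ← div_eq_mul_inv, div_le_one (by positivity)]
  exact hk'

/-- the dyadic estimate for `ϱ^w_{nkk'}(x,y)` extends to all points of
`[-1,1]^d` when `b` is componentwise nondecreasing in space. -/
theorem statement10 (d : ℕ) (w : ℝ × ℝ → EuclideanSpace ℝ (Fin d))
    (hw : ContinuousOn w (Set.Icc (0 : ℝ × ℝ) 1))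
    (b : ℝ × ℝ → EuclideanSpace ℝ (Fin d) → ℝ)
    (hmeas : Measurable fun q : (ℝ × ℝ) × EuclideanSpace ℝ (Fin d) => b q.1 q.2)
    (hbdd : ∀ p x, |b p x| ≤ 1)
    (hmono : ∀ p (x y : EuclideanSpace ℝ (Fin d)), (∀ i, x i ≤ y i) → b p x ≤ b p y)
    (C₁ : ℝ) (hC₁ : 0 < C₁)
    (hdyadic : ∀ x y : EuclideanSpace ℝ (Fin d),
      IsDyadicPoint x → IsDyadicPoint y → (∀ i, |x i| ≤ 1) → (∀ i, |y i| ≤ 1) →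
      ∀ n k k' : ℕ, 1 ≤ n → k ≤ 2 ^ n - 1 → k' ≤ 2 ^ n - 1 →
        |∫ s in Set.Ioc ((k' : ℝ) * (2:ℝ) ^ (-(n:ℤ))) (((k' : ℝ) + 1) * (2:ℝ) ^ (-(n:ℤ))),
           ∫ t in Set.Ioc ((k : ℝ) * (2:ℝ) ^ (-(n:ℤ))) (((k : ℝ) + 1) * (2:ℝ) ^ (-(n:ℤ))),
             (b (s, t) (w (s, t) + x) - b (s, t) (w (s, t) + y))|
          ≤ C₁ * (2:ℝ) ^ (-(n:ℤ)) *
              (Real.sqrt n + Real.sqrt (max (Real.log (1 / ‖x - y‖)) 0)) * ‖x - y‖) :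
    ∀ x y : EuclideanSpace ℝ (Fin d), (∀ i, |x i| ≤ 1) → (∀ i, |y i| ≤ 1) →
      ∀ n k k' : ℕ, 1 ≤ n → k ≤ 2 ^ n - 1 → k' ≤ 2 ^ n - 1 →
        |∫ s in Set.Ioc ((k' : ℝ) * (2:ℝ) ^ (-(n:ℤ))) (((k' : ℝ) + 1) * (2:ℝ) ^ (-(n:ℤ))),
           ∫ t in Set.Ioc ((k : ℝ) * (2:ℝ) ^ (-(n:ℤ))) (((k : ℝ) + 1) * (2:ℝ) ^ (-(n:ℤ))),
             (b (s, t) (w (s, t) + x) - b (s, t) (w (s, t) + y))|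
          ≤ C₁ * (2:ℝ) ^ (-(n:ℤ)) *
              (Real.sqrt n + Real.sqrt (max (Real.log (1 / ‖x - y‖)) 0)) * ‖x - y‖ := by
  classical
  intro x y hx hy n k k' hn hk hk'
  obtain rfl | hxy := eq_or_ne x y
  · simp
  set J := Ioc ((k : ℝ) * (2:ℝ) ^ (-(n:ℤ))) (((k : ℝ) + 1) * (2:ℝ) ^ (-(n:ℤ))) with hJ
  set J' := Ioc ((k' : ℝ) * (2:ℝ) ^ (-(n:ℤ))) (((k' : ℝ) + 1) * (2:ℝ) ^ (-(n:ℤ))) with hJ'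
  have hwm : Measurable ((Icc (0 : ℝ × ℝ) 1).piecewise w 0) :=
    hw.measurable_piecewise continuousOn_const measurableSet_Icc
  set v := (Icc (0 : ℝ × ℝ) 1).piecewise w 0
  have hcongr : ∀ x y, ∫ s in J', ∫ t in J, (b (s, t) (w (s, t) + x) - b (s, t) (w (s, t) + y))
      = ∫ s in J', ∫ t in J, (b (s, t) (v (s, t) + x) - b (s, t) (v (s, t) + y)) := by
    intro x y
    refine setIntegral_congr_fun measurableSet_Ioc fun s hs => ?_
    refine setIntegral_congr_fun measurableSet_Ioc fun t ht => ?_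
    have hs' := dyadic_Ioc_subset_Icc hk' hs
    have ht' := dyadic_Ioc_subset_Icc hk ht
    have hvw : v (s, t) = w (s, t) :=
      piecewise_eq_of_mem _ _ _ ⟨⟨hs'.1, ht'.1⟩, ⟨hs'.2, ht'.2⟩⟩
    simp only [hvw]
  have hmono' : ∀ x y x' y' : EuclideanSpace ℝ (Fin d), (∀ i, x i ≤ x' i) → (∀ i, y' i ≤ y i) →
      ∫ s in J', ∫ t in J, (b (s, t) (w (s, t) + x) - b (s, t) (w (s, t) + y))
      ≤ ∫ s in J', ∫ t in J, (b (s, t) (w (s, t) + x') - b (s, t) (w (s, t) + y')) := by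
    intro x y x' y' hx hy
    rw [hcongr, hcongr]
    have hbm : ∀ z, Measurable fun p : ℝ × ℝ => b p (v p + z) := fun z =>
      hmeas.comp (measurable_id.prodMk (hwm.add_const z))
    have hbM : ∀ z z' p, |b p (v p + z) - b p (v p + z')| ≤ 2 := fun z z' p =>
      (abs_sub _ _).trans (by linarith [hbdd p (v p + z), hbdd p (v p + z')])
    exact iterated_setIntegral_mono (f := fun p => b p (v p + x) - b p (v p + y))
      (g := fun p => b p (v p + x') - b p (v p + y')) ((hbm x).sub (hbm y))
      ((hbm x').sub (hbm y')) (hbM x y) (hbM x' y')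
      (fun p => sub_le_sub (hmono p _ _ fun i => by simpa using hx i)
        (hmono p _ _ fun i => by simpa using hy i))
      (by simp [hJ']) (by simp [hJ])
  have hcont : ∀ {u z : ℕ → EuclideanSpace ℝ (Fin d)}, Tendsto u atTop (𝓝 x) →
      Tendsto z atTop (𝓝 y) → Tendsto (fun m => C₁ * (2:ℝ) ^ (-(n:ℤ)) *
        (Real.sqrt n + Real.sqrt (max (Real.log (1 / ‖u m - z m‖)) 0)) * ‖u m - z m‖) atTop
        (𝓝 (C₁ * (2:ℝ) ^ (-(n:ℤ)) *
        (Real.sqrt n + Real.sqrt (max (Real.log (1 / ‖x - y‖)) 0)) * ‖x - y‖)) := by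
    intro u z hu hz
    have hpos : ‖x - y‖ ≠ 0 := norm_ne_zero_iff.2 (sub_ne_zero.2 hxy)
    have hnorm := (hu.sub hz).norm
    have hlog := (tendsto_const_nhds (x := (1 : ℝ)).div hnorm hpos).log (one_div_ne_zero hpos)
    exact (((hlog.max tendsto_const_nhds).sqrt.const_add _).const_mul _).mul hnorm
  obtain ⟨xu, hxu, hxu', hxxu, hxu_lim⟩ := exists_dyadic_seq_ge x hx
  obtain ⟨yu, hyu, hyu', hyyu, hyu_lim⟩ := exists_dyadic_seq_ge y hy
  obtain ⟨xl, hxl, hxl', hxxl, hxl_lim⟩ := exists_dyadic_seq_le x hx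
  obtain ⟨yl, hyl, hyl', hyyl, hyl_lim⟩ := exists_dyadic_seq_le y hy
  refine abs_le.2 ⟨neg_le.1 ?_, ?_⟩
  · refine ge_of_tendsto' (hcont hxl_lim hyu_lim) fun m => ?_
    refine (neg_le_neg (hmono' _ _ _ _ (hxxl m) (hyyu m))).trans ((neg_le_abs _).trans ?_)
    exact hdyadic _ _ (hxl m) (hyu m) (hxl' m) (hyu' m) n k k' hn hk hk'
  · refine ge_of_tendsto' (hcont hxu_lim hyl_lim) fun m => ?_
    refine (hmono' _ _ _ _ (hxxu m) (hyyl m)).trans ((le_abs_self _).trans ?_)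
    exact hdyadic _ _ (hxu m) (hyl m) (hxu' m) (hyl' m) n k k' hn hk hk'
end
end

section
/- Let w : [0,1]^2 → ℝ^d be a continuous function and let b : [0,1]^2 × ℝ^d → ℝ be Borel measurable with |b(s,t,x)| ≤ 1 everywhere and with b(s,t,·) componentwise nondecreasing for every (s,t). Let C₂ > 0 and suppose that for all dyadic points x ∈ [−1,1]^d and all integers n ≥ 1, 0 ≤ k, k' ≤ 2^n − 1 one has |ϱ^w_{nkk'}(0,x)| ≤ C₂ √n 2^{−n} ( |x| + 2^{−4^n} ). Then the same bound |ϱ^w_{nkk'}(0,x)| ≤ C₂ √n 2^{−n} ( |x| + 2^{−4^n} ) holds for all (not necessarily dyadic) x ∈ [−1,1]^d and all such n, k, k'. -/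
open MeasureTheory Set

noncomputable section

open Filter Topology

/-- The iterated integral over a rectangle of a bounded measurable function is monotone. -/
theorem setIntegral_setIntegral_mono_of_bounded {f g : ℝ × ℝ → ℝ} (hf : Measurable f)
    (hg : Measurable g) {M : ℝ} (hfM : ∀ p, |f p| ≤ M) (hgM : ∀ p, |g p| ≤ M)
    (hfg : ∀ p, f p ≤ g p) (a b c e : ℝ) :
    ∫ s in Ioc a b, ∫ t in Ioc c e, f (s, t) ≤ ∫ s in Ioc a b, ∫ t in Ioc c e, g (s, t) := by
  have inner : ∀ {h : ℝ × ℝ → ℝ}, Measurable h → (∀ p, |h p| ≤ M) → ∀ s,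
      Integrable (fun t => h (s, t)) (volume.restrict (Ioc c e)) := fun hh hM s =>
    Integrable.of_bound (hh.comp measurable_prodMk_left).aestronglyMeasurable M
      (ae_of_all _ fun t => hM (s, t))
  have outer : ∀ {h : ℝ × ℝ → ℝ}, Measurable h → (∀ p, |h p| ≤ M) →
      Integrable (fun s => ∫ t in Ioc c e, h (s, t)) (volume.restrict (Ioc a b)) := fun hh hM =>
    Integrable.of_bound hh.stronglyMeasurable.integral_prod_right'.aestronglyMeasurable
      (M * (volume.restrict (Ioc c e)).real univ) (ae_of_all _ fun s =>
        norm_integral_le_of_norm_le_const (ae_of_all _ fun t => hM (s, t)))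
  exact integral_mono (outer hf hfM) (outer hg hgM) fun s =>
    integral_mono (inner hf hfM s) (inner hg hgM s) fun t => hfg (s, t)

/-- Increments of a bounded field that is componentwise nondecreasing in space, integrated along
a function continuous on the unit square, are antitone in the shift. -/
theorem setIntegral_setIntegral_sub_shift_anti {d : ℕ} {w : ℝ × ℝ → EuclideanSpace ℝ (Fin d)}
    (hw : ContinuousOn w (Icc (0 : ℝ × ℝ) 1)) {b : ℝ × ℝ → EuclideanSpace ℝ (Fin d) → ℝ}
    (hmeas : Measurable fun q : (ℝ × ℝ) × EuclideanSpace ℝ (Fin d) => b q.1 q.2)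
    (hbdd : ∀ p x, |b p x| ≤ 1)
    (hmono : ∀ p (x y : EuclideanSpace ℝ (Fin d)), (∀ i, x i ≤ y i) → b p x ≤ b p y)
    {x y : EuclideanSpace ℝ (Fin d)} (hxy : ∀ i, x i ≤ y i) {a₀ a₁ c₀ c₁ : ℝ}
    (ha₀ : 0 ≤ a₀) (ha₁ : a₁ ≤ 1) (hc₀ : 0 ≤ c₀) (hc₁ : c₁ ≤ 1) :
    ∫ s in Ioc a₀ a₁, ∫ t in Ioc c₀ c₁, (b (s, t) (w (s, t)) - b (s, t) (w (s, t) + y)) ≤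
      ∫ s in Ioc a₀ a₁, ∫ t in Ioc c₀ c₁, (b (s, t) (w (s, t)) - b (s, t) (w (s, t) + x)) := by
  classical
  set v : ℝ × ℝ → EuclideanSpace ℝ (Fin d) := (Icc (0 : ℝ × ℝ) 1).piecewise w 0 with hv
  have hvm : Measurable v :=
    hw.measurable_piecewise continuousOn_const measurableSet_Icc
  have hint : ∀ z : EuclideanSpace ℝ (Fin d),
      ∫ s in Ioc a₀ a₁, ∫ t in Ioc c₀ c₁, (b (s, t) (w (s, t)) - b (s, t) (w (s, t) + z)) =
      ∫ s in Ioc a₀ a₁, ∫ t in Ioc c₀ c₁, (b (s, t) (v (s, t)) - b (s, t) (v (s, t) + z)) := by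
    intro z
    refine setIntegral_congr_fun measurableSet_Ioc fun s hs => ?_
    refine setIntegral_congr_fun measurableSet_Ioc fun t ht => ?_
    have hmem : (s, t) ∈ Icc (0 : ℝ × ℝ) 1 :=
      ⟨⟨ha₀.trans hs.1.le, hc₀.trans ht.1.le⟩, ⟨hs.2.trans ha₁, ht.2.trans hc₁⟩⟩
    simp only [hv, piecewise_eq_of_mem _ _ _ hmem]
  have hm : ∀ z : EuclideanSpace ℝ (Fin d),
      Measurable fun p : ℝ × ℝ => b p (v p) - b p (v p + z) := fun z =>
    (hmeas.comp (measurable_id.prodMk hvm)).sub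
      (hmeas.comp (measurable_id.prodMk (hvm.add_const z)))
  have hM : ∀ (z : EuclideanSpace ℝ (Fin d)) p, |b p (v p) - b p (v p + z)| ≤ 1 + 1 := fun z p =>
    (abs_sub _ _).trans (add_le_add (hbdd _ _) (hbdd _ _))
  rw [hint, hint]
  refine setIntegral_setIntegral_mono_of_bounded (hm y) (hm x) (hM y) (hM x) (fun p => ?_) _ _ _ _
  exact sub_le_sub_left (hmono _ _ _ fun i => by simpa using hxy i) _

theorem IsDyadicPoint.neg {d : ℕ} {x : EuclideanSpace ℝ (Fin d)} (hx : IsDyadicPoint x) :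
    IsDyadicPoint (-x) := fun i => by
  obtain ⟨m, l, h⟩ := hx i
  exact ⟨-m, l, by simp [h, neg_div]⟩

/-- A point of `[-1,1]^d` is a limit of dyadic points of `[-1,1]^d` lying below it. -/
theorem exists_seq_isDyadicPoint_le {d : ℕ} (x : EuclideanSpace ℝ (Fin d)) (hx : ∀ i, |x i| ≤ 1) :
    ∃ y : ℕ → EuclideanSpace ℝ (Fin d), (∀ l, IsDyadicPoint (y l)) ∧ (∀ l i, |y l i| ≤ 1) ∧
      (∀ l i, y l i ≤ x i) ∧ Tendsto y atTop (𝓝 x) := by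
  have hle : ∀ (l : ℕ) (r : ℝ), (⌊r * 2 ^ l⌋ : ℝ) / 2 ^ l ≤ r := fun l r => by
    rw [div_le_iff₀ (by positivity)]
    exact Int.floor_le _
  refine ⟨fun l => WithLp.toLp 2 fun i => (⌊x i * 2 ^ l⌋ : ℝ) / 2 ^ l, fun l i => ⟨_, l, rfl⟩,
    fun l i => ?_, fun l i => hle l (x i), ?_⟩
  · obtain ⟨h₁, h₂⟩ := abs_le.1 (hx i)
    refine abs_le.2 ⟨?_, (hle l (x i)).trans h₂⟩
    have hp : (0 : ℝ) < 2 ^ l := by positivity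
    have : (-2 ^ l : ℤ) ≤ ⌊x i * 2 ^ l⌋ := Int.le_floor.2 (by push_cast; nlinarith)
    have : (-2 ^ l : ℝ) ≤ ⌊x i * 2 ^ l⌋ := by exact_mod_cast this
    change -1 ≤ (⌊x i * 2 ^ l⌋ : ℝ) / 2 ^ l
    rw [le_div_iff₀ hp]
    linarith
  · refine ((PiLp.continuous_toLp 2 _).tendsto (WithLp.ofLp x)).comp (tendsto_pi_nhds.2 fun i => ?_)
    have hlim : Tendsto (fun l : ℕ => x i - (1 / 2 : ℝ) ^ l) atTop (𝓝 (x i)) := by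
      simpa using tendsto_const_nhds.sub
        (tendsto_pow_atTop_nhds_zero_of_lt_one (by norm_num : (0 : ℝ) ≤ 1 / 2) (by norm_num))
    refine tendsto_of_tendsto_of_tendsto_of_le_of_le hlim tendsto_const_nhds (fun l => ?_)
      fun l => hle l (x i)
    have hp : (0 : ℝ) < 2 ^ l := by positivity
    change x i - (1 / 2 : ℝ) ^ l ≤ (⌊x i * 2 ^ l⌋ : ℝ) / 2 ^ l
    rw [le_div_iff₀ hp, sub_mul, ← mul_pow]
    norm_num
    linarith [Int.lt_floor_add_one (x i * 2 ^ l)]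

/-- The right endpoint of a dyadic interval of the unit interval is at most one. -/
theorem natCast_add_one_mul_two_zpow_neg_le_one {n k : ℕ} (hk : k ≤ 2 ^ n - 1) :
    ((k : ℝ) + 1) * (2 : ℝ) ^ (-(n : ℤ)) ≤ 1 := by
  have h : k + 1 ≤ 2 ^ n := by have := Nat.one_le_two_pow (n := n); omega
  have h' : (k : ℝ) + 1 ≤ 2 ^ n := by exact_mod_cast h
  rw [zpow_neg, zpow_natCast, ← div_eq_mul_inv, div_le_one (by positivity)]
  exact h'

/-- the dyadic estimate for `ϱ^w_{nkk'}(0,x)` extends to all points of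
`[-1,1]^d` when `b` is componentwise nondecreasing in space. -/
theorem statement11 (d : ℕ) (w : ℝ × ℝ → EuclideanSpace ℝ (Fin d))
    (hw : ContinuousOn w (Set.Icc (0 : ℝ × ℝ) 1))
    (b : ℝ × ℝ → EuclideanSpace ℝ (Fin d) → ℝ)
    (hmeas : Measurable fun q : (ℝ × ℝ) × EuclideanSpace ℝ (Fin d) => b q.1 q.2)
    (hbdd : ∀ p x, |b p x| ≤ 1)
    (hmono : ∀ p (x y : EuclideanSpace ℝ (Fin d)), (∀ i, x i ≤ y i) → b p x ≤ b p y)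
    (C₂ : ℝ) (hC₂ : 0 < C₂)
    (hdyadic : ∀ x : EuclideanSpace ℝ (Fin d),
      IsDyadicPoint x → (∀ i, |x i| ≤ 1) →
      ∀ n k k' : ℕ, 1 ≤ n → k ≤ 2 ^ n - 1 → k' ≤ 2 ^ n - 1 →
        |∫ s in Set.Ioc ((k' : ℝ) * (2:ℝ) ^ (-(n:ℤ))) (((k' : ℝ) + 1) * (2:ℝ) ^ (-(n:ℤ))),
           ∫ t in Set.Ioc ((k : ℝ) * (2:ℝ) ^ (-(n:ℤ))) (((k : ℝ) + 1) * (2:ℝ) ^ (-(n:ℤ))),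
             (b (s, t) (w (s, t)) - b (s, t) (w (s, t) + x))|
          ≤ C₂ * Real.sqrt n * (2:ℝ) ^ (-(n:ℤ)) * (‖x‖ + (2:ℝ) ^ (-(4 ^ n : ℤ)))) :
    ∀ x : EuclideanSpace ℝ (Fin d), (∀ i, |x i| ≤ 1) →
      ∀ n k k' : ℕ, 1 ≤ n → k ≤ 2 ^ n - 1 → k' ≤ 2 ^ n - 1 →
        |∫ s in Set.Ioc ((k' : ℝ) * (2:ℝ) ^ (-(n:ℤ))) (((k' : ℝ) + 1) * (2:ℝ) ^ (-(n:ℤ))),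
           ∫ t in Set.Ioc ((k : ℝ) * (2:ℝ) ^ (-(n:ℤ))) (((k : ℝ) + 1) * (2:ℝ) ^ (-(n:ℤ))),
             (b (s, t) (w (s, t)) - b (s, t) (w (s, t) + x))|
          ≤ C₂ * Real.sqrt n * (2:ℝ) ^ (-(n:ℤ)) * (‖x‖ + (2:ℝ) ^ (-(4 ^ n : ℤ))) := by
  intro x hx n k k' hn hk hk'
  obtain ⟨y, hyd, hy1, hyx, hyt⟩ := exists_seq_isDyadicPoint_le x hx
  obtain ⟨z, hzd, hz1, hzx, hzt⟩ := exists_seq_isDyadicPoint_le (-x) (by simpa using hx)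
  have hlim : Tendsto (fun l => C₂ * Real.sqrt n * (2:ℝ) ^ (-(n:ℤ)) *
      (max ‖y l‖ ‖-z l‖ + (2:ℝ) ^ (-(4 ^ n : ℤ)))) atTop
      (𝓝 (C₂ * Real.sqrt n * (2:ℝ) ^ (-(n:ℤ)) * (‖x‖ + (2:ℝ) ^ (-(4 ^ n : ℤ))))) := by
    have := hyt.norm.max hzt.neg.norm
    rw [neg_neg, max_self] at this
    exact (this.add_const _).const_mul _
  refine ge_of_tendsto' hlim fun l => ?_
  have anti : ∀ {u v : EuclideanSpace ℝ (Fin d)}, (∀ i, u i ≤ v i) → _ := fun {u v} huv =>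
    setIntegral_setIntegral_sub_shift_anti hw hmeas hbdd hmono huv
      (a₀ := (k' : ℝ) * (2:ℝ) ^ (-(n:ℤ))) (c₀ := (k : ℝ) * (2:ℝ) ^ (-(n:ℤ)))
      (by positivity) (natCast_add_one_mul_two_zpow_neg_le_one hk')
      (by positivity) (natCast_add_one_mul_two_zpow_neg_le_one hk)
  refine (abs_le_max_abs_abs (anti (v := -z l) fun i => ?_) (anti (hyx l))).trans (max_le ?_ ?_)
  · have := hzx l i
    simp only [PiLp.neg_apply] at this ⊢
    linarith
  · refine (hdyadic _ (hzd l).neg (by simpa using hz1 l) n k k' hn hk hk').trans ?_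
    gcongr
    exact le_max_right _ _
  · refine (hdyadic _ (hyd l) (hy1 l) n k k' hn hk hk').trans ?_
    gcongr
    exact le_max_left _ _
end
end
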